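/- arXiv:1803.09003 — 2 statements merged into one kernel-verified Lean document; each statement's English description precedes it below -/
import Mathlib

section
/- Let P and P' be binary patterns such that P is an interval minor of P' (equivalently, Av(P) ⊆ Av(P')... note this is the containment Av(P) ⊆ Av(P') induced by P ≼ P'). If the class Av(P') is bounded, then the class Av(P) is bounded as well. -/
/-!
Common framework: binary matrices, interval minors, criticality, 0-runs,
row/column complexity, embeddings and related notions, following
Jelínek–Kučera, "On the structure of matrices avoiding interval-minor
patterns". All indices are 0-based.
-/

/-- A binary matrix: dimensions `m × n`, with entries given by a total
function (entries outside the range `[0,m) × [0,n)` are irrelevant: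
all definitions below only inspect in-range entries). -/
structure BMat where
  m : ℕ
  n : ℕ
  entry : ℕ → ℕ → Bool

namespace BMat

/-- The support of a binary matrix: its set of (in-range) 1-entries. -/
def supp (M : BMat) : Set (ℕ × ℕ) :=
  {p | p.1 < M.m ∧ p.2 < M.n ∧ M.entry p.1 p.2 = true}

/-- `M'` is obtained from `M` by contracting two adjacent rows `r`, `r+1`. -/
def RowCon (M M' : BMat) : Prop :=
  ∃ r, r + 1 < M.m ∧ M'.m + 1 = M.m ∧ M'.n = M.n ∧
    ∀ i j, i < M'.m → j < M'.n →
      M'.entry i j =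
        if i < r then M.entry i j
        else if i = r then (M.entry r j || M.entry (r + 1) j)
        else M.entry (i + 1) j

/-- `M'` is obtained from `M` by contracting two adjacent columns `c`, `c+1`. -/
def ColCon (M M' : BMat) : Prop :=
  ∃ c, c + 1 < M.n ∧ M'.n + 1 = M.n ∧ M'.m = M.m ∧
    ∀ i j, i < M'.m → j < M'.n →
      M'.entry i j =
        if j < c then M.entry i j
        else if j = c then (M.entry i c || M.entry i (c + 1))
        else M.entry i (j + 1)

/-- One contraction step (of a row or of a column). -/
def Con (M M' : BMat) : Prop := RowCon M M' ∨ ColCon M M'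

/-- `P` is an interval minor of `M`: `M` can be transformed by a sequence of
row and column contractions into a matrix of the same dimensions as `P`
dominating `P`. -/
def IntervalMinor (P M : BMat) : Prop :=
  ∃ M', Relation.ReflTransGen Con M M' ∧ M'.m = P.m ∧ M'.n = P.n ∧
    ∀ i j, i < P.m → j < P.n → P.entry i j = true → M'.entry i j = true

/-- `M` avoids `P` as an interval minor. -/
def Avoids (P M : BMat) : Prop := ¬ IntervalMinor P M

/-- The class of all matrices avoiding `P` as an interval minor. -/
def Av (P : BMat) : Set BMat := {M | Avoids P M}

/-- The class of all matrices avoiding every pattern of `F` as an interval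
minor. -/
def AvF (F : Set BMat) : Set BMat := {M | ∀ P ∈ F, Avoids P M}

/-- The matrix obtained from `M` by changing the entry at position `(i, j)`
into a 1-entry. -/
def setOne (M : BMat) (i j : ℕ) : BMat :=
  ⟨M.m, M.n, fun a b => if a = i ∧ b = j then true else M.entry a b⟩

/-- `M` is critical for the class `C`: it lies in `C`, but changing any
single 0-entry of `M` into a 1-entry leaves `C`. -/
def CriticalFor (C : Set BMat) (M : BMat) : Prop :=
  M ∈ C ∧ ∀ i j, i < M.m → j < M.n → M.entry i j = false → setOne M i j ∉ C

/-- The number of horizontal 0-runs in row `r` of `M`, counted via their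
starting columns. -/
noncomputable def rowRunCount (M : BMat) (r : ℕ) : ℕ :=
  Set.ncard {j | j < M.n ∧ M.entry r j = false ∧ (j = 0 ∨ M.entry r (j - 1) = true)}

/-- The number of vertical 0-runs in column `c` of `M`. -/
noncomputable def colRunCount (M : BMat) (c : ℕ) : ℕ :=
  Set.ncard {i | i < M.m ∧ M.entry i c = false ∧ (i = 0 ∨ M.entry (i - 1) c = true)}

/-- A class is row-bounded if there is a uniform bound on the number of
0-runs in any row of any matrix that is critical for the class. -/
def RowBounded (C : Set BMat) : Prop :=
  ∃ K, ∀ M, CriticalFor C M → ∀ r, r < M.m → rowRunCount M r ≤ K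

/-- A class is column-bounded if there is a uniform bound on the number of
0-runs in any column of any matrix that is critical for the class. -/
def ColBounded (C : Set BMat) : Prop :=
  ∃ K, ∀ M, CriticalFor C M → ∀ c, c < M.n → colRunCount M c ≤ K

/-- A class is bounded if it is both row-bounded and column-bounded. -/
def Bounded (C : Set BMat) : Prop := RowBounded C ∧ ColBounded C

/-- The pattern `Q₁`, with support `{(1,2),(2,1),(3,3)}` (1-based). -/
def Q1 : BMat :=
  ⟨3, 3, fun i j => (i == 0 && j == 1) || (i == 1 && j == 0) || (i == 2 && j == 2)⟩

/-- The pattern `Q₂`, with support `{(1,2),(2,3),(3,1)}` (1-based). -/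
def Q2 : BMat :=
  ⟨3, 3, fun i j => (i == 0 && j == 1) || (i == 1 && j == 2) || (i == 2 && j == 0)⟩

/-- The pattern `Q₃`, with support `{(1,1),(2,3),(3,2)}` (1-based). -/
def Q3 : BMat :=
  ⟨3, 3, fun i j => (i == 0 && j == 0) || (i == 1 && j == 2) || (i == 2 && j == 1)⟩

/-- The pattern `Q₄`, with support `{(1,3),(2,1),(3,2)}` (1-based). -/
def Q4 : BMat :=
  ⟨3, 3, fun i j => (i == 0 && j == 2) || (i == 1 && j == 0) || (i == 2 && j == 1)⟩

/-- The diagonal pattern `D_k`, with support `{(i,i) : i ∈ [k]}`. -/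
def D (k : ℕ) : BMat := ⟨k, k, fun i j => i == j⟩

/-- The antidiagonal pattern `D̄_k`, with support `{(i, k+1-i) : i ∈ [k]}`
(1-based). -/
def Dbar (k : ℕ) : BMat := ⟨k, k, fun i j => i + j + 1 == k⟩

/-- An embedding of `P` into `M`: 1-entries go to 1-entries, and the map is
strictly monotone in rows and in columns. -/
def IsEmbedding (P M : BMat) (φ : ℕ → ℕ → ℕ × ℕ) : Prop :=
  (∀ i j, i < P.m → j < P.n → (φ i j).1 < M.m ∧ (φ i j).2 < M.n) ∧
  (∀ i j, i < P.m → j < P.n → P.entry i j = true →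
      M.entry (φ i j).1 (φ i j).2 = true) ∧
  (∀ i₁ j₁ i₂ j₂, i₁ < P.m → j₁ < P.n → i₂ < P.m → j₂ < P.n →
      (i₁ < i₂ → (φ i₁ j₁).1 < (φ i₂ j₂).1) ∧
      (j₁ < j₂ → (φ i₁ j₁).2 < (φ i₂ j₂).2))

/-- A partition of `M` containing `P` (via row indices `r 0 < ⋯ < r P.m ≤ M.m`
and column indices `c 0 < ⋯ < c P.n ≤ M.n`). -/
def PartitionContains (M P : BMat) : Prop :=
  ∃ r c : ℕ → ℕ,
    (∀ i, i < P.m → r i < r (i + 1)) ∧ (∀ j, j < P.n → c j < c (j + 1)) ∧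
    r P.m ≤ M.m ∧ c P.n ≤ M.n ∧
    ∀ i j, i < P.m → j < P.n → P.entry i j = true →
      ∃ a b, r i ≤ a ∧ a < r (i + 1) ∧ c j ≤ b ∧ b < c (j + 1) ∧
        M.entry a b = true

/-- A partial embedding of `P` into `M`, defined on a nonempty set `S` of
entries of `P`. -/
def IsPartialEmbedding (P M : BMat) (S : Set (ℕ × ℕ)) (ψ : ℕ × ℕ → ℕ × ℕ) : Prop :=
  S.Nonempty ∧ (∀ e ∈ S, e.1 < P.m ∧ e.2 < P.n) ∧
  (∀ i j, i < P.m → j < P.n → P.entry i j = true →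
      (i, j) ∈ S ∧ M.entry (ψ (i, j)).1 (ψ (i, j)).2 = true) ∧
  (∀ e ∈ S, (ψ e).1 < M.m ∧ (ψ e).2 < M.n ∧
      e.1 ≤ (ψ e).1 ∧ e.2 ≤ (ψ e).2 ∧
      P.m - 1 - e.1 ≤ M.m - 1 - (ψ e).1 ∧ P.n - 1 - e.2 ≤ M.n - 1 - (ψ e).2) ∧
  (∀ e₁ ∈ S, ∀ e₂ ∈ S,
      (e₁.1 < e₂.1 → e₂.1 - e₁.1 ≤ (ψ e₂).1 - (ψ e₁).1) ∧
      (e₁.2 < e₂.2 → e₂.2 - e₁.2 ≤ (ψ e₂).2 - (ψ e₁).2))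

/-- A horizontal 0-run of `M` in row `r`, occupying exactly columns
`c₁, …, c₂`. -/
def ZeroRun (M : BMat) (r c₁ c₂ : ℕ) : Prop :=
  r < M.m ∧ c₁ ≤ c₂ ∧ c₂ < M.n ∧
  (∀ j, c₁ ≤ j → j ≤ c₂ → M.entry r j = false) ∧
  (c₁ = 0 ∨ M.entry r (c₁ - 1) = true) ∧
  (c₂ + 1 = M.n ∨ M.entry r (c₂ + 1) = true)

/-- The 0-entry `f` of `M` is critical for the 1-entry `e` of `P`: some
embedding of `P` into `M △ f` maps `e` to `f`. -/
def CritEntry (P : BMat) (e : ℕ × ℕ) (M : BMat) (f : ℕ × ℕ) : Prop :=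
  f.1 < M.m ∧ f.2 < M.n ∧ M.entry f.1 f.2 = false ∧
  ∃ φ, IsEmbedding P (setOne M f.1 f.2) φ ∧ φ e.1 e.2 = f

/-- The number of horizontal 0-runs in row `r` of `M` that are critical for
the 1-entry `e` of `P` (counted via their starting columns). -/
noncomputable def critRunCount (P : BMat) (e : ℕ × ℕ) (M : BMat) (r : ℕ) : ℕ :=
  Set.ncard {c₁ | ∃ c₂, ZeroRun M r c₁ c₂ ∧
    ∃ c, c₁ ≤ c ∧ c ≤ c₂ ∧ CritEntry P e M (r, c)}

/-- The 1-entry `e` of `P` is row-bounding: every row of every `P`-avoiding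
matrix contains a bounded number of 0-runs critical for `e`. -/
def EntryRowBounding (P : BMat) (e : ℕ × ℕ) : Prop :=
  ∃ K, ∀ M, Avoids P M → ∀ r, critRunCount P e M r ≤ K

/-- An increasing walk from `e` to `e'`: a sequence of positions, each step
moving one column to the right or one row up, with `W` its set of
positions. -/
def IsIncreasingWalk (W : Set (ℕ × ℕ)) (e e' : ℕ × ℕ) : Prop :=
  ∃ (t : ℕ) (f : ℕ → ℕ × ℕ), f 0 = e ∧ f t = e' ∧
    W = {x | ∃ i, i ≤ t ∧ f i = x} ∧
    ∀ i, i < t →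
      ((f (i + 1)).1 = (f i).1 ∧ (f (i + 1)).2 = (f i).2 + 1) ∨
      ((f (i + 1)).1 + 1 = (f i).1 ∧ (f (i + 1)).2 = (f i).2)

/-- All 1-entries of `P` can be covered by at most `k` lines
(rows or columns). -/
def CoveredByLines (P : BMat) (k : ℕ) : Prop :=
  ∃ (R C : Finset ℕ), R.card + C.card ≤ k ∧
    ∀ i j, i < P.m → j < P.n → P.entry i j = true → i ∈ R ∨ j ∈ C

/-- Clockwise rotation by 90 degrees. -/
def rot90 (P : BMat) : BMat := ⟨P.n, P.m, fun i j => P.entry (P.m - 1 - j) i⟩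

/-- Rotation by 180 degrees. -/
def rot180 (P : BMat) : BMat :=
  ⟨P.m, P.n, fun i j => P.entry (P.m - 1 - i) (P.n - 1 - j)⟩

/-- Clockwise rotation by 270 degrees. -/
def rot270 (P : BMat) : BMat := ⟨P.n, P.m, fun i j => P.entry j (P.n - 1 - i)⟩

/-- Reflection turning the matrix upside down (reversing the rows). -/
def reflRows (P : BMat) : BMat := ⟨P.m, P.n, fun i j => P.entry (P.m - 1 - i) j⟩

/-- Reflection reversing the columns. -/
def reflCols (P : BMat) : BMat := ⟨P.m, P.n, fun i j => P.entry i (P.n - 1 - j)⟩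

/-- Reflection along the main diagonal (transposition). -/
def transposeB (P : BMat) : BMat := ⟨P.n, P.m, fun i j => P.entry j i⟩

/-- Reflection along the antidiagonal. -/
def antitransposeB (P : BMat) : BMat :=
  ⟨P.n, P.m, fun i j => P.entry (P.m - 1 - j) (P.n - 1 - i)⟩

/-- Type 1 pattern of Lemma `lem-2types`: rows `r < r' < r''`, columns
`c < c'`, with `supp ⊆ ({r'} × [c,c']) ∪ {(r,c),(r'',c),(r,c'),(r'',c')}`. -/
def TypeOne (P₀ : BMat) : Prop :=
  ∃ r r' r'' c c', r < r' ∧ r' < r'' ∧ r'' < P₀.m ∧ c < c' ∧ c' < P₀.n ∧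
    ∀ i j, i < P₀.m → j < P₀.n → P₀.entry i j = true →
      (i = r' ∧ c ≤ j ∧ j ≤ c') ∨ ((i = r ∨ i = r'') ∧ (j = c ∨ j = c'))

/-- Type 2 pattern of Lemma `lem-2types`: rows `r < r'`, columns `c < c'`,
with `supp ⊆ ({r} × [c,c']) ∪ ({r'} × [1,c]) ∪ ([1,r] × {c'}) ∪ {(r',c')}`. -/
def TypeTwo (P₀ : BMat) : Prop :=
  ∃ r r' c c', r < r' ∧ r' < P₀.m ∧ c < c' ∧ c' < P₀.n ∧
    ∀ i j, i < P₀.m → j < P₀.n → P₀.entry i j = true →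
      (i = r ∧ c ≤ j ∧ j ≤ c') ∨ (i = r' ∧ j ≤ c) ∨ (i ≤ r ∧ j = c') ∨
      (i = r' ∧ j = c')

/-- A minor-closed class of binary matrices. -/
def MinorClosed (C : Set BMat) : Prop :=
  ∀ M ∈ C, ∀ P, IntervalMinor P M → P ∈ C

/-- The 4×3 pattern with support `{(1,2),(2,1),(3,2),(4,3)}` (1-based), from
Proposition `pro-counter`. -/
def P18 : BMat :=
  ⟨4, 3, fun i j => (i == 0 && j == 1) || (i == 1 && j == 0) ||
    (i == 2 && j == 1) || (i == 3 && j == 2)⟩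

end BMat

open BMat

namespace BMat

theorem mono_step {R : ℕ → ℕ} {m : ℕ} (h : ∀ s, s < m → R s < R (s+1)) :
    ∀ s t, s ≤ t → t ≤ m → R s + (t - s) ≤ R t := by
  intro s t hst htm
  induction t, hst using Nat.le_induction with
  | base => simp
  | succ t hst ih =>
    have := ih (by omega)
    have := h t (by omega)
    omega

/-- block form of interval-minor containment -/
def Has (P M : BMat) : Prop :=
  ∃ R C : ℕ → ℕ, R 0 = 0 ∧ R P.m = M.m ∧ C 0 = 0 ∧ C P.n = M.n ∧
    (∀ s, s < P.m → R s < R (s+1)) ∧ (∀ c, c < P.n → C c < C (c+1)) ∧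
    ∀ s c, s < P.m → c < P.n → P.entry s c = true →
      ∃ i j, R s ≤ i ∧ i < R (s+1) ∧ C c ≤ j ∧ j < C (c+1) ∧ M.entry i j = true

theorem Has.tr {P M : BMat} (h : Has P M) : Has (transposeB P) (transposeB M) := by
  obtain ⟨R, C, h1, h2, h3, h4, h5, h6, h7⟩ := h
  refine ⟨C, R, h3, h4, h1, h2, h6, h5, ?_⟩
  intro s c hs hc he
  obtain ⟨i, j, a1, a2, a3, a4, a5⟩ := h7 c s hc hs he
  exact ⟨j, i, a3, a4, a1, a2, a5⟩

theorem ColCon.tr {M M' : BMat} (h : ColCon M M') : RowCon (transposeB M) (transposeB M') := by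
  obtain ⟨c, h1, h2, h3, h4⟩ := h
  exact ⟨c, h1, h2, h3, fun i j hi hj => h4 j i hj hi⟩

theorem RowCon.tr {M M' : BMat} (h : RowCon M M') : ColCon (transposeB M) (transposeB M') := by
  obtain ⟨c, h1, h2, h3, h4⟩ := h
  exact ⟨c, h1, h2, h3, fun i j hi hj => h4 j i hj hi⟩

theorem has_rowCon {P M M' : BMat} (hc : RowCon M M') (h : Has P M') : Has P M := by
  obtain ⟨r, hr, hm, hn, he⟩ := hc
  obtain ⟨R, C, h1, h2, h3, h4, h5, h6, h7⟩ := h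
  refine ⟨fun t => if R t ≤ r then R t else R t + 1, C, ?_, ?_, h3, by omega, ?_, h6, ?_⟩
  · simp [h1]
  · simp only [h2]; split_ifs <;> omega
  · intro s hs; have := h5 s hs; simp only; split_ifs <;> omega
  · intro s c hs hc' hP
    obtain ⟨i, j, a1, a2, a3, a4, a5⟩ := h7 s c hs hc' hP
    have b1 := mono_step h5 (s+1) P.m (by omega) le_rfl
    have b2 := mono_step h6 (c+1) P.n (by omega) le_rfl
    have := he i j (by omega) (by omega)
    rw [this] at a5
    simp only
    split_ifs at a5 with c1 c2
    · refine ⟨i, j, ?_, ?_, a3, a4, a5⟩ <;> split_ifs <;> omega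
    · rw [Bool.or_eq_true] at a5
      rcases a5 with a5 | a5
      · refine ⟨r, j, ?_, ?_, a3, a4, a5⟩ <;> split_ifs <;> omega
      · refine ⟨r+1, j, ?_, ?_, a3, a4, a5⟩ <;> split_ifs <;> omega
    · refine ⟨i+1, j, ?_, ?_, a3, a4, a5⟩ <;> split_ifs <;> omega

theorem has_of_minor {P M : BMat} (h : IntervalMinor P M) : Has P M := by
  obtain ⟨M', hs, hm, hn, he⟩ := h
  induction hs using Relation.ReflTransGen.head_induction_on with
  | refl =>
    exact ⟨id, id, rfl, hm.symm, rfl, hn.symm, by simp, by simp, fun s c a b d =>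
      ⟨s, c, le_rfl, by simp, le_rfl, by simp, he s c a b d⟩⟩
  | head h1 _ ih =>
    rcases h1 with h1 | h1
    · exact has_rowCon h1 ih
    · exact (has_rowCon h1.tr ih.tr).tr

theorem has_rowStep {P M : BMat} (h : Has P M) (hlt : P.m < M.m) :
    ∃ M', RowCon M M' ∧ Has P M' := by
  obtain ⟨R, C, h1, h2, h3, h4, h5, h6, h7⟩ := h
  have : ∃ s, s < P.m ∧ R s + 1 < R (s+1) := by
    by_contra hcon
    push Not at hcon
    have : ∀ t, t ≤ P.m → R t ≤ t := by
      intro t; induction t with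
      | zero => intro; omega
      | succ t ih => intro ht; have := ih (by omega); have := hcon t (by omega); omega
    have := this P.m le_rfl
    omega
  obtain ⟨s, hs, hgap⟩ := this
  have hmono := mono_step h5
  have b0 := hmono (s+1) P.m (by omega) le_rfl
  refine ⟨⟨M.m - 1, M.n, fun i j => if i < R s then M.entry i j
        else if i = R s then (M.entry (R s) j || M.entry (R s + 1) j)
        else M.entry (i + 1) j⟩, ⟨R s, by omega, by simp; omega, rfl, fun i j _ _ => rfl⟩, ?_⟩
  refine ⟨fun t => if t ≤ s then R t else R t - 1, C, by simp [h1], ?_, h3, h4, ?_, h6, ?_⟩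
  · simp only; split_ifs <;> omega
  · intro t ht
    have := h5 t ht
    simp only
    split_ifs with c1 c2 c2
    · omega
    · have : t = s := by omega
      subst this; omega
    · omega
    · have := hmono (s+1) t (by omega) (by omega); omega
  · intro t c ht hc hP
    obtain ⟨i, j, a1, a2, a3, a4, a5⟩ := h7 t c ht hc hP
    simp only
    rcases lt_trichotomy t s with hts | hts | hts
    · have := hmono (t+1) s (by omega) (by omega)
      refine ⟨i, j, ?_, ?_, a3, a4, ?_⟩
      · split_ifs <;> omega
      · split_ifs <;> omega
      · rw [if_pos (by omega)]; exact a5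
    · subst hts
      by_cases hi : i ≤ R t + 1
      · refine ⟨R t, j, ?_, ?_, a3, a4, ?_⟩
        · split_ifs <;> omega
        · split_ifs <;> omega
        · have : i = R t ∨ i = R t + 1 := by omega
          rcases this with rfl | rfl <;> simp [a5]
      · refine ⟨i-1, j, ?_, ?_, a3, a4, ?_⟩
        · split_ifs <;> omega
        · split_ifs <;> omega
        · rw [if_neg (by omega), if_neg (by omega), show i - 1 + 1 = i by omega]; exact a5
    · have := hmono (s+1) t (by omega) (by omega)
      refine ⟨i-1, j, ?_, ?_, a3, a4, ?_⟩
      · split_ifs <;> omega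
      · split_ifs <;> omega
      · rw [if_neg (by omega), if_neg (by omega), show i - 1 + 1 = i by omega]; exact a5

theorem minor_of_con {P M M' : BMat} (hc : Con M M') (h : IntervalMinor P M') :
    IntervalMinor P M := by
  obtain ⟨N, a, b⟩ := h
  exact ⟨N, Relation.ReflTransGen.head hc a, b⟩

theorem minor_of_has {P M : BMat} (h : Has P M) : IntervalMinor P M := by
  induction hk : M.m + M.n using Nat.strong_induction_on generalizing M with
  | _ k ih =>
    by_cases hm : P.m < M.m
    · obtain ⟨M', hc, hM'⟩ := has_rowStep h hm
      refine minor_of_con (Or.inl hc) (ih (M'.m + M'.n) ?_ hM' rfl)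
      obtain ⟨r, a, b, c, d⟩ := hc
      omega
    by_cases hn : P.n < M.n
    · obtain ⟨M', hc, hM'⟩ := has_rowStep h.tr hn
      refine minor_of_con (M' := transposeB M') (Or.inr hc.tr) (ih (M'.n + M'.m) ?_ hM'.tr rfl)
      obtain ⟨r, a, b, c, d⟩ := hc
      simp only [transposeB] at *
      omega
    obtain ⟨R, C, h1, h2, h3, h4, h5, h6, h7⟩ := h
    have r1 := mono_step h5 0 P.m (by omega) le_rfl
    have c1 := mono_step h6 0 P.n (by omega) le_rfl
    refine ⟨M, Relation.ReflTransGen.refl, by omega, by omega, ?_⟩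
    intro i j hi hj hP
    obtain ⟨i', j', a1, a2, a3, a4, a5⟩ := h7 i j hi hj hP
    have e1 := mono_step h5 0 i (by omega) (by omega)
    have e2 := mono_step h5 (i+1) P.m (by omega) le_rfl
    have e3 := mono_step h6 0 j (by omega) (by omega)
    have e4 := mono_step h6 (j+1) P.n (by omega) le_rfl
    rw [show i = i' by omega, show j = j' by omega]; exact a5

theorem minor_iff_has {P M : BMat} : IntervalMinor P M ↔ Has P M := ⟨has_of_minor, minor_of_has⟩

/-- loose cuts are enough -/
theorem has_of_loose {P M : BMat} (hm : 0 < P.m) (hn : 0 < P.n) (R C : ℕ → ℕ)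
    (hR : ∀ s, s < P.m → R s < R (s+1)) (hC : ∀ c, c < P.n → C c < C (c+1))
    (hRm : R P.m ≤ M.m) (hCn : C P.n ≤ M.n)
    (h7 : ∀ s c, s < P.m → c < P.n → P.entry s c = true →
      ∃ i j, R s ≤ i ∧ i < R (s+1) ∧ C c ≤ j ∧ j < C (c+1) ∧ M.entry i j = true) : Has P M := by
  refine ⟨fun s => if s = 0 then 0 else if s = P.m then M.m else R s,
    fun s => if s = 0 then 0 else if s = P.n then M.n else C s, by simp, by simp; omega,
    by simp, by simp; omega, ?_, ?_, ?_⟩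
  · intro s hs
    have := hR s hs
    have := mono_step hR (s+1) P.m (by omega) le_rfl
    simp only; split_ifs <;> first | omega | contradiction
  · intro s hs
    have := hC s hs
    have := mono_step hC (s+1) P.n (by omega) le_rfl
    simp only; split_ifs <;> first | omega | contradiction
  · intro s c hs hc hP
    obtain ⟨i, j, a1, a2, a3, a4, a5⟩ := h7 s c hs hc hP
    have := mono_step hR (s+1) P.m (by omega) le_rfl
    have := mono_step hC (c+1) P.n (by omega) le_rfl
    refine ⟨i, j, ?_, ?_, ?_, ?_, a5⟩ <;> simp only <;> split_ifs <;> first | omega | contradiction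

theorem Has.mono {P M M' : BMat} (h : Has P M) (hm : M.m = M'.m) (hn : M.n = M'.n)
    (he : ∀ i j, i < M.m → j < M.n → M.entry i j = true → M'.entry i j = true) : Has P M' := by
  obtain ⟨R, C, h1, h2, h3, h4, h5, h6, h7⟩ := h
  refine ⟨R, C, h1, by omega, h3, by omega, h5, h6, ?_⟩
  intro s c hs hc hP
  obtain ⟨i, j, a1, a2, a3, a4, a5⟩ := h7 s c hs hc hP
  have := mono_step h5 (s+1) P.m (by omega) le_rfl
  have := mono_step h6 (c+1) P.n (by omega) le_rfl
  exact ⟨i, j, a1, a2, a3, a4, he i j (by omega) (by omega) a5⟩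

theorem Has.reflR {P M : BMat} (h : Has P M) : Has (reflRows P) (reflRows M) := by
  obtain ⟨R, C, h1, h2, h3, h4, h5, h6, h7⟩ := h
  refine ⟨fun s => M.m - R (P.m - s), C, ?_, ?_, h3, h4, ?_, h6, ?_⟩
  · simp [h2]
  · simp [reflRows, h1]
  · intro s hs
    simp only [reflRows] at hs
    have := h5 (P.m - (s+1)) (by omega)
    rw [show P.m - (s+1) + 1 = P.m - s by omega] at this
    have := mono_step h5 (P.m - s) P.m (by omega) le_rfl
    simp only; omega
  · intro s c hs hc hP
    simp only [reflRows] at hs hc hP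
    obtain ⟨i, j, a1, a2, a3, a4, a5⟩ := h7 (P.m - 1 - s) c (by omega) hc hP
    rw [show P.m - 1 - s + 1 = P.m - s by omega] at a2
    rw [show P.m - 1 - s = P.m - (s+1) by omega] at a1
    have := mono_step h5 (P.m - s) P.m (by omega) le_rfl
    refine ⟨M.m - 1 - i, j, by simp only; omega, by simp only; omega, a3, a4, ?_⟩
    simp only [reflRows]
    rw [show M.m - 1 - (M.m - 1 - i) = i by omega]; exact a5

theorem reflCols_eq (P : BMat) : reflCols P = transposeB (reflRows (transposeB P)) := rfl

theorem Has.reflC {P M : BMat} (h : Has P M) : Has (reflCols P) (reflCols M) := h.tr.reflR.tr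

end BMat

namespace BMat

theorem Has.pmono {P P' M : BMat} (h : Has P M) (hm : P.m = P'.m) (hn : P.n = P'.n)
    (he : ∀ i j, i < P.m → j < P.n → P'.entry i j = true → P.entry i j = true) : Has P' M := by
  obtain ⟨R, C, h1, h2, h3, h4, h5, h6, h7⟩ := h
  refine ⟨R, C, h1, by rw [← hm]; exact h2, h3, by rw [← hn]; exact h4, by rw [← hm]; exact h5,
    by rw [← hn]; exact h6, ?_⟩
  intro s c hs hc hP
  exact h7 s c (by omega) (by omega) (he s c (by omega) (by omega) hP)

theorem reflRR {P M : BMat} (h : Has (reflRows P) (reflRows M)) : Has P M := by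
  refine (h.reflR.pmono (P' := P) rfl rfl ?_).mono (M' := M) rfl rfl ?_
  · intro i j hi hj h
    simp only [reflRows] at *
    rw [show P.m - 1 - (P.m - 1 - i) = i by omega]; exact h
  · intro i j hi hj h
    simp only [reflRows] at *
    rw [show M.m - 1 - (M.m - 1 - i) = i by omega] at h; exact h

theorem reflCC {P M : BMat} (h : Has (reflCols P) (reflCols M)) : Has P M :=
  (reflRR (P := transposeB P) (M := transposeB M) h.tr).tr

/-- witness of many critical zeros in a row -/
def Wit (P : BMat) (K : ℕ) : Prop :=
  ∃ (M : BMat) (r : ℕ) (F : Finset ℕ), r < M.m ∧ ¬ Has P M ∧ K ≤ F.card ∧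
    (∀ f ∈ F, f < M.n ∧ M.entry r f = false ∧ Has P (setOne M r f)) ∧
    ∀ f ∈ F, ∀ f' ∈ F, f < f' → ∃ g, f < g ∧ g < f' ∧ M.entry r g = true

theorem exists_critical (P : BMat) (M : BMat) (h : ¬ Has P M) :
    ∃ M', M'.m = M.m ∧ M'.n = M.n ∧ CriticalFor (Av P) M' ∧
      ∀ i j, M.entry i j = true → M'.entry i j = true := by
  induction hk : (((Finset.range M.m) ×ˢ (Finset.range M.n)).filter
    (fun p => M.entry p.1 p.2 = false)).card using Nat.strong_induction_on generalizing M with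
  | _ k ih =>
    by_cases hc : CriticalFor (Av P) M
    · exact ⟨M, rfl, rfl, hc, fun _ _ h => h⟩
    have hMA : M ∈ Av P := by
      intro h'; exact h (has_of_minor h')
    simp only [CriticalFor, not_and] at hc
    have hc := hc hMA
    push Not at hc
    obtain ⟨i, j, hi, hj, hz, hA⟩ := hc
    have hA' : ¬ Has P (setOne M i j) := fun h' => hA (minor_of_has h')
    obtain ⟨M', a1, a2, a3, a4⟩ := ih _ (by
      rw [← hk]
      apply Finset.card_lt_card
      rw [Finset.ssubset_iff_of_subset]
      · refine ⟨(i, j), by simp [hi, hj, hz], by simp [setOne]⟩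
      · intro p hp
        rw [Finset.mem_filter] at hp ⊢
        refine ⟨hp.1, ?_⟩
        have := hp.2
        simp only [setOne] at this
        split_ifs at this
        exact this) (setOne M i j) hA' rfl
    refine ⟨M', a1, a2, a3, fun x y hxy => a4 x y ?_⟩
    simp [setOne, hxy]

theorem not_wit_of_rowBounded {P : BMat} (h : RowBounded (Av P)) : ∃ K, ¬ Wit P K := by
  obtain ⟨K, hK⟩ := h
  refine ⟨K+1, ?_⟩
  rintro ⟨M, r, F, hr, hA, hF, hf, hg⟩
  obtain ⟨M', hm, hn, hcr, hle⟩ := exists_critical P M hA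
  have hK := hK M' hcr r (by omega)
  have hz : ∀ f ∈ F, M'.entry r f = false := by
    intro f hfF
    by_contra hne
    rw [Bool.not_eq_false] at hne
    apply hcr.1
    apply minor_of_has
    refine (hf f hfF).2.2.mono hm.symm hn.symm ?_
    intro i j _ _ hij
    simp only [setOne] at hij
    split_ifs at hij with hc
    · rw [hc.1, hc.2]; exact hne
    · exact hle _ _ hij
  have hst : ∀ f, ∃ s, f ∈ F → s ≤ f ∧ (∀ j, s ≤ j → j ≤ f → M'.entry r j = false) ∧
      (s = 0 ∨ M'.entry r (s-1) = true) := by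
    intro f
    by_cases hfF : f ∈ F
    · have hex : ∃ s, s ≤ f ∧ ∀ j, s ≤ j → j ≤ f → M'.entry r j = false :=
        ⟨f, le_rfl, fun j h1 h2 => by rw [show j = f by omega]; exact hz f hfF⟩
      classical
      refine ⟨Nat.find hex, fun _ => ⟨(Nat.find_spec hex).1, (Nat.find_spec hex).2, ?_⟩⟩
      by_contra hcon
      push Not at hcon
      obtain ⟨h0, h1⟩ := hcon
      have := Nat.find_min hex (m := Nat.find hex - 1) (by omega)
      apply this
      refine ⟨by have := (Nat.find_spec hex).1; omega, ?_⟩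
      intro j hj1 hj2
      by_cases hj : j = Nat.find hex - 1
      · rw [hj]; simpa using h1
      · exact (Nat.find_spec hex).2 j (by omega) hj2
    · exact ⟨0, fun h => absurd h hfF⟩
  choose st hst using hst
  have hlt : ∀ f ∈ F, ∀ f' ∈ F, f < f' → st f < st f' := by
    intro f h1 f' h2 h3
    obtain ⟨g, g1, g2, g3⟩ := hg f h1 f' h2 h3
    have := (hst f h1).1
    by_contra hcon
    have := (hst f' h2).2.1 g (by omega) (by omega)
    rw [hle _ _ g3] at this
    cases this
  have : F.card ≤ rowRunCount M' r := by
    unfold rowRunCount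
    rw [← Set.ncard_coe_finset]
    have hfin : {j | j < M'.n ∧ M'.entry r j = false ∧
        (j = 0 ∨ M'.entry r (j - 1) = true)}.Finite :=
      (Set.finite_lt_nat M'.n).subset fun x hx => hx.1
    refine Set.ncard_le_ncard_of_injOn st ?_ ?_ hfin
    · intro f hfF
      have h1 := hst f hfF
      have h2 := (hf f hfF).1
      exact ⟨by omega, h1.2.1 _ le_rfl h1.1, h1.2.2⟩
    · intro f h1 f' h2 he
      rcases lt_trichotomy f f' with h | h | h
      · have := hlt f h1 f' h2 h; omega
      · exact h
      · have := hlt f' h2 f h1 h; omega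
  omega

theorem wit_of_not_rowBounded {P : BMat} (h : ¬ RowBounded (Av P)) (K : ℕ) : Wit P K := by
  unfold RowBounded at h
  push Not at h
  obtain ⟨M, hcr, r, hr, hK⟩ := h K
  have hfin : {j | j < M.n ∧ M.entry r j = false ∧ (j = 0 ∨ M.entry r (j - 1) = true)}.Finite :=
    (Set.finite_lt_nat M.n).subset fun x hx => hx.1
  refine ⟨M, r, hfin.toFinset, hr, fun h' => hcr.1 (minor_of_has h'), ?_, ?_, ?_⟩
  · unfold rowRunCount at hK
    rw [Set.ncard_eq_toFinset_card _ hfin] at hK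
    omega
  · intro f hf
    rw [Set.Finite.mem_toFinset] at hf
    refine ⟨hf.1, hf.2.1, ?_⟩
    have := hcr.2 r f hr hf.1 hf.2.1
    by_contra hcon
    exact this fun h' => hcon (has_of_minor h')
  · intro f hf f' hf' hlt
    rw [Set.Finite.mem_toFinset] at hf hf'
    have h1 : M.entry r (f' - 1) = true := by
      rcases hf'.2.2 with h | h
      · omega
      · exact h
    refine ⟨f' - 1, ?_, by omega, h1⟩
    by_contra hcon
    have : f' - 1 = f := by omega
    rw [this, hf.2.1] at h1
    cases h1

theorem Wit.reflC {P : BMat} {K : ℕ} (h : Wit P K) : Wit (reflCols P) K := by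
  obtain ⟨M, r, F, hr, hA, hF, hf, hg⟩ := h
  refine ⟨reflCols M, r, F.image (fun f => M.n - 1 - f), hr, fun h => hA (reflCC h), ?_, ?_, ?_⟩
  · rw [Finset.card_image_of_injOn]
    · exact hF
    · intro a ha b hb hab
      have h1 := (hf a ha).1
      have h2 := (hf b hb).1
      simp only at hab
      omega
  · intro f' hf'
    rw [Finset.mem_image] at hf'
    obtain ⟨f, hfF, rfl⟩ := hf'
    obtain ⟨a, b, c⟩ := hf f hfF
    refine ⟨by simp only [reflCols]; omega, ?_, ?_⟩
    · simp only [reflCols]; rw [show M.n - 1 - (M.n - 1 - f) = f by omega]; exact b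
    · refine c.reflC.mono rfl rfl ?_
      intro i j hi hj h
      simp only [reflCols, setOne] at *
      split_ifs at h ⊢ with h1 h2 h2
      all_goals first | rfl | exact h | omega
  · intro a' ha' b' hb' hlt
    rw [Finset.mem_image] at ha' hb'
    obtain ⟨a, ha, rfl⟩ := ha'
    obtain ⟨b, hb, rfl⟩ := hb'
    have h1 := (hf a ha).1
    have h2 := (hf b hb).1
    obtain ⟨g, g1, g2, g3⟩ := hg b hb a ha (by omega)
    refine ⟨M.n - 1 - g, by omega, by omega, ?_⟩
    simp only [reflCols]; rw [show M.n - 1 - (M.n - 1 - g) = g by omega]; exact g3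

theorem Wit.reflR {P : BMat} {K : ℕ} (h : Wit P K) : Wit (reflRows P) K := by
  obtain ⟨M, r, F, hr, hA, hF, hf, hg⟩ := h
  have e : M.m - 1 - (M.m - 1 - r) = r := by omega
  refine ⟨reflRows M, M.m - 1 - r, F, by simp only [reflRows]; omega,
    fun h => hA (reflRR h), hF, ?_, ?_⟩
  · intro f hfF
    obtain ⟨a, b, c⟩ := hf f hfF
    refine ⟨a, by simp only [reflRows, e]; exact b, ?_⟩
    refine c.reflR.mono rfl rfl ?_
    intro i j hi hj h
    simp only [reflRows, setOne] at *
    split_ifs at h ⊢ with h1 h2 h2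
    all_goals first | rfl | exact h | omega
  · intro a ha b hb hlt
    obtain ⟨g, g1, g2, g3⟩ := hg a ha b hb hlt
    exact ⟨g, g1, g2, by simp only [reflRows, e]; exact g3⟩

theorem Wit.pcongr {P P' : BMat} {K : ℕ} (h : Wit P K) (hm : P.m = P'.m) (hn : P.n = P'.n)
    (he : ∀ i j, i < P.m → j < P.n → P'.entry i j = P.entry i j) : Wit P' K := by
  obtain ⟨M, r, F, hr, hA, hF, hf, hg⟩ := h
  refine ⟨M, r, F, hr, fun h => hA (h.pmono hm.symm hn.symm fun i j hi hj h => ?_), hF,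
    fun f hfF => ⟨(hf f hfF).1, (hf f hfF).2.1, (hf f hfF).2.2.pmono hm hn
      fun i j hi hj h => ?_⟩, hg⟩
  · rw [he i j (by omega) (by omega)]; exact h
  · rw [← he i j hi hj]; exact h

theorem Wit.ofReflC {P : BMat} {K : ℕ} (h : Wit (reflCols P) K) : Wit P K := by
  refine h.reflC.pcongr rfl rfl ?_
  intro i j hi hj
  simp only [reflCols] at *
  rw [show P.n - 1 - (P.n - 1 - j) = j by omega]

theorem Wit.ofReflR {P : BMat} {K : ℕ} (h : Wit (reflRows P) K) : Wit P K := by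
  refine h.reflR.pcongr rfl rfl ?_
  intro i j hi hj
  simp only [reflRows] at *
  rw [show P.m - 1 - (P.m - 1 - i) = i by omega]

end BMat

namespace BMat

/-- contiguous window of a pattern -/
def win (P : BMat) (i0 j0 m' n' : ℕ) : BMat := ⟨m', n', fun i j => P.entry (i0 + i) (j0 + j)⟩

theorem wit_border {P : BMat} {i0 j0 m' n' K : ℕ} (hm : i0 + m' ≤ P.m) (hn : j0 + n' ≤ P.n)
    (hm0 : 0 < m') (hn0 : 0 < n') (h : Wit (win P i0 j0 m' n') K) : Wit P K := by
  obtain ⟨M, r, F, hr, hA, hF, hf, hg⟩ := h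
  set M' : BMat := ⟨M.m + (P.m - m'), M.n + (P.n - n'), fun i j =>
    if i0 ≤ i ∧ i < i0 + M.m ∧ j0 ≤ j ∧ j < j0 + M.n then M.entry (i - i0) (j - j0) else true⟩
    with hM'
  have hent : ∀ i j, i < M.m → j < M.n → M'.entry (i0 + i) (j0 + j) = M.entry i j := by
    intro i j hi hj
    simp only [hM']
    rw [if_pos (by omega)]; congr 1 <;> omega
  refine ⟨M', i0 + r, F.image (fun f => j0 + f), by simp only [hM']; omega, ?_, ?_, ?_, ?_⟩
  · rintro ⟨R, C, h1, h2, h3, h4, h5, h6, h7⟩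
    apply hA
    simp only [hM'] at h2 h4
    have r1 := mono_step h5 0 i0 (by omega) (by omega)
    have r2 := mono_step h5 (i0+m') P.m (by omega) (by omega)
    have c1 := mono_step h6 0 j0 (by omega) (by omega)
    have c2 := mono_step h6 (j0+n') P.n (by omega) (by omega)
    refine has_of_loose hm0 hn0 (fun s => R (i0 + s) - i0) (fun c => C (j0 + c) - j0)
      ?_ ?_ ?_ ?_ ?_
    · intro s hs
      simp only [win] at hs
      have := h5 (i0 + s) (by omega)
      have := mono_step h5 i0 (i0+s) (by omega) (by omega)
      simp only [← add_assoc]; omega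
    · intro s hs
      simp only [win] at hs
      have := h6 (j0 + s) (by omega)
      have := mono_step h6 j0 (j0+s) (by omega) (by omega)
      simp only [← add_assoc]; omega
    · simp only [win]; omega
    · simp only [win]; omega
    · intro s c hs hc hP
      simp only [win] at hs hc hP
      obtain ⟨i, j, a1, a2, a3, a4, a5⟩ := h7 (i0 + s) (j0 + c) (by omega) (by omega) hP
      have := mono_step h5 i0 (i0+s) (by omega) (by omega)
      have := mono_step h6 j0 (j0+c) (by omega) (by omega)
      have := mono_step h5 (i0+s+1) (i0+m') (by omega) (by omega)
      have := mono_step h6 (j0+c+1) (j0+n') (by omega) (by omega)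
      refine ⟨i - i0, j - j0, ?_, ?_, ?_, ?_, ?_⟩
      · omega
      · simp only [← add_assoc]; omega
      · omega
      · simp only [← add_assoc]; omega
      · rw [← hent _ _ (by omega) (by omega)]
        rw [show i0 + (i - i0) = i by omega, show j0 + (j - j0) = j by omega]; exact a5
  · rw [Finset.card_image_of_injective]
    · exact hF
    · intro a b h; simpa using h
  · intro f' hf'
    rw [Finset.mem_image] at hf'
    obtain ⟨f, hfF, rfl⟩ := hf'
    obtain ⟨a, b, c⟩ := hf f hfF
    refine ⟨by simp only [hM']; omega, ?_, ?_⟩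
    · rw [hent _ _ hr a]; exact b
    · obtain ⟨R, C, h1, h2, h3, h4, h5, h6, h7⟩ := c
      simp only [win, setOne] at h2 h4 h5 h6 h7
      have r0 := mono_step h5 0 m' (by omega) (by omega)
      have c0 := mono_step h6 0 n' (by omega) (by omega)
      refine has_of_loose (by omega) (by omega)
        (fun s => if s ≤ i0 then s else if s ≤ i0 + m' then i0 + R (s - i0) else M.m + (s - m'))
        (fun s => if s ≤ j0 then s else if s ≤ j0 + n' then j0 + C (s - j0) else M.n + (s - n'))
        ?_ ?_ ?_ ?_ ?_
      · intro s hs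
        by_cases k1 : s < i0
        · rw [if_pos (by omega), if_pos (by omega)]; omega
        by_cases k2 : s < i0 + m'
        · have := h5 (s - i0) (by omega)
          rw [show s - i0 + 1 = s + 1 - i0 by omega] at this
          by_cases k3 : s = i0
          · subst k3; rw [if_pos le_rfl, if_neg (by omega), if_pos (by omega)]; omega
          · rw [if_neg (by omega), if_pos (by omega), if_neg (by omega), if_pos (by omega)]; omega
        · by_cases k3 : s = i0 + m'
          · subst k3; rw [if_neg (by omega), if_pos (by omega), if_neg (by omega), if_neg (by omega)]
            rw [show i0 + m' - i0 = m' by omega]; omega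
          · rw [if_neg (by omega), if_neg (by omega), if_neg (by omega), if_neg (by omega)]; omega
      · intro s hs
        by_cases k1 : s < j0
        · rw [if_pos (by omega), if_pos (by omega)]; omega
        by_cases k2 : s < j0 + n'
        · have := h6 (s - j0) (by omega)
          rw [show s - j0 + 1 = s + 1 - j0 by omega] at this
          by_cases k3 : s = j0
          · subst k3; rw [if_pos le_rfl, if_neg (by omega), if_pos (by omega)]; omega
          · rw [if_neg (by omega), if_pos (by omega), if_neg (by omega), if_pos (by omega)]; omega
        · by_cases k3 : s = j0 + n'
          · subst k3; rw [if_neg (by omega), if_pos (by omega), if_neg (by omega), if_neg (by omega)]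
            rw [show j0 + n' - j0 = n' by omega]; omega
          · rw [if_neg (by omega), if_neg (by omega), if_neg (by omega), if_neg (by omega)]; omega
      · simp only [setOne, hM']
        by_cases k : P.m = i0 + m'
        · rw [if_neg (by omega), if_pos (by omega), show P.m - i0 = m' by omega]; omega
        · rw [if_neg (by omega), if_neg (by omega)]
      · simp only [setOne, hM']
        by_cases k : P.n = j0 + n'
        · rw [if_neg (by omega), if_pos (by omega), show P.n - j0 = n' by omega]; omega
        · rw [if_neg (by omega), if_neg (by omega)]
      · intro s c hs hc hP
        by_cases hw : i0 ≤ s ∧ s < i0 + m' ∧ j0 ≤ c ∧ c < j0 + n'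
        · obtain ⟨i, j, a1, a2, a3, a4, a5⟩ := h7 (s - i0) (c - j0) (by omega) (by omega)
            (by rw [show i0 + (s - i0) = s by omega, show j0 + (c - j0) = c by omega]; exact hP)
          rw [show s - i0 + 1 = s + 1 - i0 by omega] at a2
          rw [show c - j0 + 1 = c + 1 - j0 by omega] at a4
          have q1 := mono_step h5 (s+1-i0) m' (by omega) (by omega)
          have q2 := mono_step h6 (c+1-j0) n' (by omega) (by omega)
          refine ⟨i0 + i, j0 + j, ?_, ?_, ?_, ?_, ?_⟩
          · split_ifs <;> omega
          · split_ifs <;> omega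
          · split_ifs <;> omega
          · split_ifs <;> omega
          · simp only [setOne]
            split_ifs at a5 ⊢ with k1 k2 k2
            all_goals first | rfl | omega | (rw [hent _ _ (by omega) (by omega)]; exact a5)
        · refine ⟨if s ≤ i0 then s else if s ≤ i0 + m' then i0 + R (s - i0) else M.m + (s - m'),
            if c ≤ j0 then c else if c ≤ j0 + n' then j0 + C (c - j0) else M.n + (c - n'),
            le_rfl, ?_, le_rfl, ?_, ?_⟩
          · by_cases k1 : s < i0
            · rw [if_pos (by omega), if_pos (by omega)]; omega
            by_cases k2 : s < i0 + m'
            · have := h5 (s - i0) (by omega)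
              rw [show s - i0 + 1 = s + 1 - i0 by omega] at this
              by_cases k3 : s = i0
              · subst k3; rw [if_pos le_rfl, if_neg (by omega), if_pos (by omega)]; omega
              · rw [if_neg (by omega), if_pos (by omega), if_neg (by omega), if_pos (by omega)]
                omega
            · by_cases k3 : s = i0 + m'
              · subst k3
                rw [if_neg (by omega), if_pos (by omega), if_neg (by omega), if_neg (by omega)]
                rw [show i0 + m' - i0 = m' by omega]; omega
              · rw [if_neg (by omega), if_neg (by omega), if_neg (by omega), if_neg (by omega)]
                omega
          · by_cases k1 : c < j0
            · rw [if_pos (by omega), if_pos (by omega)]; omega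
            by_cases k2 : c < j0 + n'
            · have := h6 (c - j0) (by omega)
              rw [show c - j0 + 1 = c + 1 - j0 by omega] at this
              by_cases k3 : c = j0
              · subst k3; rw [if_pos le_rfl, if_neg (by omega), if_pos (by omega)]; omega
              · rw [if_neg (by omega), if_pos (by omega), if_neg (by omega), if_pos (by omega)]
                omega
            · by_cases k3 : c = j0 + n'
              · subst k3
                rw [if_neg (by omega), if_pos (by omega), if_neg (by omega), if_neg (by omega)]
                rw [show j0 + n' - j0 = n' by omega]; omega
              · rw [if_neg (by omega), if_neg (by omega), if_neg (by omega), if_neg (by omega)]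
                omega
          · have hmain : ∀ x y, ¬ (i0 ≤ x ∧ x < i0 + M.m ∧ j0 ≤ y ∧ y < j0 + M.n) →
                (setOne M' (i0 + r) (j0 + f)).entry x y = true := by
              intro x y hxy
              simp only [setOne, hM', if_neg hxy]
              simp
            apply hmain
            intro hh
            apply hw
            clear hw
            have e1 : s = i0 + m' → R (s - i0) = M.m := by
              intro h; rw [h, show i0 + m' - i0 = m' by omega]; exact h2
            have e2 : c = j0 + n' → C (c - j0) = M.n := by
              intro h; rw [h, show j0 + n' - j0 = n' by omega]; exact h4
            by_cases g1 : s = i0 + m' <;> by_cases g2 : c = j0 + n'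
            all_goals
              first | have e1 := e1 g1 | skip
              first | have e2 := e2 g2 | skip
              split_ifs at hh <;> omega
  · intro a' ha' b' hb' hlt
    rw [Finset.mem_image] at ha' hb'
    obtain ⟨a, ha, rfl⟩ := ha'
    obtain ⟨b, hb, rfl⟩ := hb'
    obtain ⟨g, g1, g2, g3⟩ := hg a ha b hb (by omega)
    refine ⟨j0 + g, by omega, by omega, ?_⟩
    rw [hent _ _ hr (by have := (hf b hb).1; omega)]; exact g3

end BMat

namespace BMat

/-- shorthand for an in-range one -/
def One (P : BMat) (s c : ℕ) : Prop := s < P.m ∧ c < P.n ∧ P.entry s c = true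

open Classical in
/-- the witness matrix -/
noncomputable def bigM (P : BMat) (α β b K : ℕ) : BMat :=
  ⟨P.m + β * (K-1), P.n + α * (K-1), fun i j =>
    if i = 0 then decide (¬ ∃ l, l < K ∧ j = b + α * l)
    else decide (∃ l s c, l < K ∧ 1 ≤ s ∧ One P s c ∧ i = s + β * (K-1-l) ∧ j = c + α * l)⟩

theorem bigM_zero {P : BMat} {α β b K j : ℕ} : (bigM P α β b K).entry 0 j = true ↔
    ¬ ∃ l, l < K ∧ j = b + α * l := by
  simp [bigM]

theorem bigM_pos {P : BMat} {α β b K i j : ℕ} (hi : 1 ≤ i) : (bigM P α β b K).entry i j = true ↔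
    ∃ l s c, l < K ∧ 1 ≤ s ∧ One P s c ∧ i = s + β * (K-1-l) ∧ j = c + α * l := by
  have : i ≠ 0 := by omega
  simp [bigM, this]

theorem wsum (α β K l s c : ℕ) (hl : l < K) :
    α * (s + β * (K-1-l)) + β * (c + α * l) = α * s + β * c + α * β * (K-1) := by
  obtain ⟨d, rfl⟩ : ∃ d, K = l + 1 + d := ⟨K - (l+1), by omega⟩
  rw [show l + 1 + d - 1 - l = d by omega, show l + 1 + d - 1 = l + d by omega]
  ring

theorem bigM_avoids {P : BMat} {α β b A K : ℕ} (hA0 : 0 < A) (hA : A + 1 < P.m) (hb0 : 0 < b)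
    (hb : b + 1 < P.n) (e1 : P.entry 0 b = true) (e2 : P.entry A 0 = true)
    (e3 : P.entry (P.m - 1) (P.n - 1) = true)
    (hfree : ∀ s c, One P s c → 1 ≤ s → s < A → b ≤ c)
    (hα : 0 < α) (hβ : 0 < β) (h1 : β * b < α * A) (h2 : α * A < α + β * b) :
    ¬ Has P (bigM P α β b K) := by
  rintro ⟨R, C, -, -, -, -, h5, h6, h7⟩
  have harg : ∀ s c, One P s c → 1 ≤ s → α * A ≤ α * s + β * c ∧
      (α * s + β * c ≤ α * A → s = A ∧ c = 0) := by
    intro s c ho hs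
    by_cases hsA : s < A
    · have := hfree s c ho hs hsA
      have q1 : β * b ≤ β * c := Nat.mul_le_mul_left _ this
      have q2 : α * 1 ≤ α * s := Nat.mul_le_mul_left _ hs
      constructor
      · omega
      · intro; omega
    · have q2 : α * A ≤ α * s := Nat.mul_le_mul_left _ (by omega)
      refine ⟨by omega, fun h => ?_⟩
      have hc : c = 0 := by
        by_contra hc
        have : β * 1 ≤ β * c := Nat.mul_le_mul_left _ (by omega)
        omega
      refine ⟨?_, hc⟩
      by_contra hne
      have : α * (A + 1) ≤ α * s := Nat.mul_le_mul_left _ (by omega)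
      rw [mul_add] at this
      omega
  have hmax : ∀ s c, One P s c → α * s + β * c ≤ α * (P.m - 1) + β * (P.n - 1) ∧
      (α * (P.m - 1) + β * (P.n - 1) ≤ α * s + β * c → s = P.m - 1 ∧ c = P.n - 1) := by
    intro s c ho
    have q1 : α * s ≤ α * (P.m - 1) := Nat.mul_le_mul_left _ (by have := ho.1; omega)
    have q2 : β * c ≤ β * (P.n - 1) := Nat.mul_le_mul_left _ (by have := ho.2.1; omega)
    refine ⟨by omega, fun h => ⟨?_, ?_⟩⟩
    · by_contra hne
      have : α * (s + 1) ≤ α * (P.m - 1) := Nat.mul_le_mul_left _ (by have := ho.1; omega)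
      rw [mul_add] at this; omega
    · by_contra hne
      have : β * (c + 1) ≤ β * (P.n - 1) := Nat.mul_le_mul_left _ (by have := ho.2.1; omega)
      rw [mul_add] at this; omega
  have hent : ∀ i j, 1 ≤ i → (bigM P α β b K).entry i j = true →
      ∃ l s c, l < K ∧ 1 ≤ s ∧ One P s c ∧ i = s + β * (K-1-l) ∧ j = c + α * l := by
    intro i j hi he
    exact (bigM_pos hi).1 he
  obtain ⟨i1, j1, a1, a2, a3, a4, a5⟩ := h7 A 0 (by omega) (by omega) e2
  obtain ⟨i2, j2, b1, b2, b3, b4, b5⟩ := h7 (P.m - 1) (P.n - 1) (by omega) (by omega) e3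
  obtain ⟨i0, j0, c1, c2, c3, c4, c5⟩ := h7 0 b (by omega) (by omega) e1
  have m1 := mono_step h5 1 A (by omega) (by omega)
  have m2 := mono_step h5 0 1 (by omega) (by omega)
  have m3 := mono_step h5 (A+1) (P.m-1) (by omega) (by omega)
  have m4 := mono_step h6 1 b (by omega) (by omega)
  have m5 := mono_step h6 (b+1) (P.n-1) (by omega) (by omega)
  have m6 := mono_step h6 b (b+1) (by omega) (by omega)
  simp only [zero_add] at a4 c2
  obtain ⟨l1, s1, d1, p1, p2, p3, p4, p5⟩ := hent i1 j1 (by omega) a5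
  obtain ⟨l2, s2, d2, q1, q2, q3, q4, q5⟩ := hent i2 j2 (by omega) b5
  have w1 := wsum α β K l1 s1 d1 p1
  have w2 := wsum α β K l2 s2 d2 q1
  rw [← p4, ← p5] at w1
  rw [← q4, ← q5] at w2
  have di : α * (i1 + (P.m - 1 - A)) ≤ α * i2 := Nat.mul_le_mul_left _ (by omega)
  have dj : β * (j1 + (P.n - 1)) ≤ β * j2 := Nat.mul_le_mul_left _ (by omega)
  rw [mul_add] at di dj
  have hsplit : α * (P.m - 1) = α * A + α * (P.m - 1 - A) := by
    rw [← mul_add]; congr 1; omega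
  have g1 := harg s1 d1 p3 p2
  have g2 := hmax s2 d2 q3
  obtain ⟨rfl, rfl⟩ := g1.2 (by omega)
  obtain ⟨rfl, rfl⟩ := g2.2 (by omega)
  have l12 : l1 = l2 := by
    apply le_antisymm
    · by_contra hne
      have : α * (l2 + 1) ≤ α * l1 := Nat.mul_le_mul_left _ (by omega)
      rw [mul_add] at this; omega
    · by_contra hne
      have : β * (K - 1 - l2 + 1) ≤ β * (K - 1 - l1) := Nat.mul_le_mul_left _ (by omega)
      rw [mul_add] at this; omega
  subst l12
  have hj0 : j0 = b + α * l1 := by omega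
  have hi0 : i0 ≤ β * (K - 1 - l1) := by omega
  by_cases hz : i0 = 0
  · subst hz
    exact bigM_zero.1 c5 ⟨l1, p1, hj0⟩
  · obtain ⟨l, s, c, t1, t2, t3, t4, t5⟩ := hent i0 j0 (by omega) c5
    have w0 := wsum α β K l s c t1
    rw [← t4, ← t5] at w0
    have g0 := (harg s c t3 t2).1
    have u1 : α * i0 ≤ α * (β * (K - 1 - l1)) := Nat.mul_le_mul_left _ hi0
    have w3 := wsum α β K l1 0 b p1
    rw [zero_add, ← hj0] at w3
    omega

theorem bigM_has {P : BMat} {α β b A K l : ℕ} (hA : A + 1 < P.m)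
    (hb : b + 1 < P.n) (hα : P.n ≤ α) (hl : l < K) :
    Has P (setOne (bigM P α β b K) 0 (b + α * l)) := by
  have k1 : β * (K - 1 - l) ≤ β * (K-1) := Nat.mul_le_mul_left _ (by omega)
  have k2 : α * l ≤ α * (K-1) := Nat.mul_le_mul_left _ (by omega)
  refine has_of_loose (by omega) (by omega)
    (fun s => if s = 0 then 0 else s + β * (K-1-l)) (fun c => c + α * l) ?_ ?_ ?_ ?_ ?_
  · intro s hs; (try simp only); split_ifs <;> first | omega | contradiction
  · intro s hs; (try simp only); omega
  · simp only [setOne, bigM]; split_ifs <;> omega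
  · simp only [setOne, bigM]; omega
  · intro s c hs hc hP
    by_cases h0 : s = 0
    · subst h0
      refine ⟨0, c + α * l, by simp, by simp, le_rfl, by (try simp only); omega, ?_⟩
      simp only [setOne]
      split_ifs with hk
      · rfl
      · rw [bigM_zero]
        rintro ⟨l', hl', he⟩
        apply hk
        refine ⟨by trivial, ?_⟩
        rcases lt_trichotomy l l' with h | h | h
        · have : α * (l + 1) ≤ α * l' := Nat.mul_le_mul_left _ (by omega)
          rw [mul_add] at this; omega
        · subst h; omega
        · have : α * (l' + 1) ≤ α * l := Nat.mul_le_mul_left _ (by omega)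
          rw [mul_add] at this; omega
    · refine ⟨s + β * (K-1-l), c + α * l, by (try simp only); rw [if_neg h0], ?_, le_rfl,
        by (try simp only); omega, ?_⟩
      · (try simp only); rw [if_neg (by omega)]; omega
      · simp only [setOne]
        rw [if_neg (by omega), bigM_pos (by omega)]
        exact ⟨l, s, c, hl, by omega, ⟨hs, hc, hP⟩, rfl, rfl⟩

theorem wit_core {P : BMat} {b A : ℕ} (hA0 : 0 < A) (hA : A + 1 < P.m) (hb0 : 0 < b)
    (hb : b + 1 < P.n) (e1 : P.entry 0 b = true) (e2 : P.entry A 0 = true)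
    (e3 : P.entry (P.m - 1) (P.n - 1) = true)
    (hfree : ∀ s c, One P s c → 1 ≤ s → s < A → b ≤ c) (K : ℕ) : Wit P K := by
  obtain ⟨A', rfl⟩ : ∃ A', A = A' + 1 := ⟨A - 1, by omega⟩
  set α := 2 * (b * P.n) with hα
  set β := (2 * A' + 1) * P.n with hβ
  have hbn : P.n ≤ b * P.n := Nat.le_mul_of_pos_left _ hb0
  have hβ0 : 0 < β := Nat.mul_pos (by omega) (by omega)
  have x1 : β * b = 2 * (A' * (b * P.n)) + b * P.n := by rw [hβ]; ring
  have x2 : α * (A' + 1) = 2 * (A' * (b * P.n)) + 2 * (b * P.n) := by rw [hα]; ring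
  refine ⟨bigM P α β b K, 0, (Finset.range K).image (fun l => b + α * l), ?_,
    bigM_avoids hA0 hA hb0 hb e1 e2 e3 hfree (by omega) hβ0 (by omega) (by omega), ?_, ?_, ?_⟩
  · simp only [bigM]; omega
  · rw [Finset.card_image_of_injective]
    · simp
    · intro x y h
      simp only [add_right_inj] at h
      exact Nat.eq_of_mul_eq_mul_left (by omega) h
  · intro f hf
    rw [Finset.mem_image] at hf
    obtain ⟨l, hl, rfl⟩ := hf
    rw [Finset.mem_range] at hl
    have k2 : α * l ≤ α * (K-1) := Nat.mul_le_mul_left _ (by omega)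
    refine ⟨by simp only [bigM]; omega, ?_, bigM_has hA hb (by omega) hl⟩
    rw [← Bool.not_eq_true, bigM_zero, not_not]
    exact ⟨l, hl, rfl⟩
  · intro f hf f' hf' hlt
    rw [Finset.mem_image] at hf hf'
    obtain ⟨l, hl, rfl⟩ := hf
    obtain ⟨l', hl', rfl⟩ := hf'
    have hll : l < l' := by
      by_contra hne
      have : α * l' ≤ α * l := Nat.mul_le_mul_left _ (by omega)
      omega
    have k3 : α * (l + 1) ≤ α * l' := Nat.mul_le_mul_left _ (by omega)
    rw [mul_add] at k3
    refine ⟨b + α * l + 1, by omega, by omega, ?_⟩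
    rw [bigM_zero]
    rintro ⟨l'', _, he⟩
    rcases lt_trichotomy l l'' with h | h | h
    · have : α * (l + 1) ≤ α * l'' := Nat.mul_le_mul_left _ (by omega)
      rw [mul_add] at this; omega
    · subst h; omega
    · have : α * (l'' + 1) ≤ α * l := Nat.mul_le_mul_left _ (by omega)
      rw [mul_add] at this; omega

/-- 213 triple -/
theorem wit_213 {P : BMat} {a1 a2 a3 b1 b2 b3 : ℕ} (h1 : One P a1 b2) (h2 : One P a2 b1)
    (h3 : One P a3 b3) (ha : a1 < a2) (ha' : a2 < a3) (hb : b1 < b2) (hb' : b2 < b3) (K : ℕ) :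
    Wit P K := by
  classical
  have hex : ∃ x, a1 < x ∧ ∃ y, y < b2 ∧ One P x y := ⟨a2, ha, b1, hb, h2⟩
  obtain ⟨x1, y, hy, hxy⟩ := Nat.find_spec hex
  have hx2 : Nat.find hex ≤ a2 := Nat.find_min' hex ⟨ha, b1, hb, h2⟩
  have hmin := fun z hz => Nat.find_min hex (m := z) hz
  generalize Nat.find hex = x at *
  refine wit_border (i0 := a1) (j0 := y) (m' := a3 - a1 + 1) (n' := b3 - y + 1)
    (by have := h3.1; omega) (by have := h3.2.1; omega) (by omega) (by omega)
    (wit_core (b := b2 - y) (A := x - a1) (by omega) (by simp only [win]; omega) (by omega)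
      (by simp only [win]; omega) ?_ ?_ ?_ ?_ K)
  · simp only [win]; rw [show a1 + 0 = a1 by omega, show y + (b2 - y) = b2 by omega]; exact h1.2.2
  · simp only [win]; rw [show y + 0 = y by omega, show a1 + (x - a1) = x by omega]; exact hxy.2.2
  · simp only [win]
    rw [show y + (b3 - y + 1 - 1) = b3 by omega, show a1 + (a3 - a1 + 1 - 1) = a3 by omega]
    exact h3.2.2
  · rintro s c ⟨q1, q2, q3⟩ hs1 hs2
    simp only [win] at q1 q2 q3
    by_contra hcon
    exact hmin (a1 + s) (by omega) ⟨by omega, y + c, by omega, by have := h3.1; omega,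
      by have := h3.2.1; omega, q3⟩

/-- no nonmonotone triple -/
def QF (P : BMat) : Prop := ∀ i1 j1 i2 j2 i3 j3, One P i1 j1 → One P i2 j2 → One P i3 j3 →
  i1 < i2 → i2 < i3 → j1 ≠ j2 → j2 ≠ j3 → j1 ≠ j3 → (j1 < j2 ∧ j2 < j3) ∨ (j3 < j2 ∧ j2 < j1)

theorem one_reflC {P : BMat} {s c : ℕ} (h : One P s c) : One (reflCols P) s (P.n - 1 - c) := by
  obtain ⟨a, b, d⟩ := h
  refine ⟨a, by simp only [reflCols]; omega, ?_⟩
  simp only [reflCols]; rw [show P.n - 1 - (P.n - 1 - c) = c by omega]; exact d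

theorem one_reflR {P : BMat} {s c : ℕ} (h : One P s c) : One (reflRows P) (P.m - 1 - s) c := by
  obtain ⟨a, b, d⟩ := h
  refine ⟨by simp only [reflRows]; omega, b, ?_⟩
  simp only [reflRows]; rw [show P.m - 1 - (P.m - 1 - s) = s by omega]; exact d

theorem wit_231 {P : BMat} {a1 a2 a3 b1 b2 b3 : ℕ} (h1 : One P a1 b2) (h2 : One P a2 b3)
    (h3 : One P a3 b1) (ha : a1 < a2) (ha' : a2 < a3) (hb : b1 < b2) (hb' : b2 < b3) (K : ℕ) :
    Wit P K := by
  have := h2.2.1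
  exact (wit_213 (one_reflC h1) (one_reflC h2) (one_reflC h3) ha ha' (by omega) (by omega) K).ofReflC

theorem wit_of_not_QF {P : BMat} (h : ¬ QF P) (K : ℕ) : Wit P K := by
  unfold QF at h
  push Not at h
  obtain ⟨i1, j1, i2, j2, i3, j3, h1, h2, h3, l1, l2, n1, n2, n3, h4, h5⟩ := h
  have := h3.1
  by_cases c1 : j2 < j1
  · by_cases c2 : j1 < j3
    · exact wit_213 h1 h2 h3 l1 l2 c1 c2 K
    · exact (wit_213 (one_reflR h3) (one_reflR h2) (one_reflR h1) (by omega) (by omega)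
        (by omega) (by omega) K).ofReflR
  · by_cases c2 : j1 < j3
    · exact (wit_231 (one_reflR h3) (one_reflR h2) (one_reflR h1) (by omega) (by omega)
        (by omega) (by omega) K).ofReflR
    · exact wit_231 h1 h2 h3 l1 l2 (by omega) (by omega) K

end BMat

namespace BMat

/-- long sequence of near-embeddings sharing the same missing one `(a,b)` -/
structure Sq (P M : BMat) (r a b N : ℕ) (g : ℕ → ℕ) (R C : ℕ → ℕ → ℕ) : Prop where
  one : One P a b
  nh : ¬ Has P M
  Rs : ∀ l, l < N → ∀ s, s < P.m → R l s < R l (s+1)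
  Rm : ∀ l, l < N → R l P.m ≤ M.m
  Cs : ∀ l, l < N → ∀ s, s < P.n → C l s < C l (s+1)
  Cn : ∀ l, l < N → C l P.n ≤ M.n
  g1 : ∀ l, l < N → M.entry r (g l) = true
  gn : ∀ l, l < N → g l < M.n
  ra : ∀ l, l < N → R l a ≤ r ∧ r < R l (a+1)
  cg : ∀ l, l < N → C l (b+1) ≤ g l
  gc : ∀ l, l + 1 < N → g l < C (l+1) b
  wit : ∀ l, l < N → ∀ s c, One P s c → (s ≠ a ∨ c ≠ b) →
    ∃ i j, R l s ≤ i ∧ i < R l (s+1) ∧ C l c ≤ j ∧ j < C l (c+1) ∧ M.entry i j = true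

theorem Sq.gmono {P M : BMat} {r a b N : ℕ} {g : ℕ → ℕ} {R C : ℕ → ℕ → ℕ}
    (S : Sq P M r a b N g R C) : ∀ x y, x < y → y < N → g x < g y := by
  intro x y hxy hy
  induction y, hxy using Nat.le_induction with
  | base =>
    have := S.gc x hy
    have := S.Cs (x+1) hy b S.one.2.1
    have := S.cg (x+1) hy
    show g x < g (x+1)
    omega
  | succ y hxy ih =>
    have := ih (by omega)
    have := S.gc y hy
    have := S.Cs (y+1) hy b S.one.2.1
    have := S.cg (y+1) hy
    omega

theorem Sq.reflR {P M : BMat} {r a b N : ℕ} {g : ℕ → ℕ} {R C : ℕ → ℕ → ℕ}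
    (S : Sq P M r a b N g R C) : Sq (reflRows P) (reflRows M) (M.m - 1 - r) (P.m - 1 - a) b N g
      (fun l s => M.m - R l (P.m - s)) C := by
  have ha := S.one.1
  have hb : ∀ l, l < N → r < M.m := by
    intro l hl
    have := S.Rm l hl
    have := (S.ra l hl).2
    have := mono_step (S.Rs l hl) (a+1) P.m (by omega) le_rfl
    omega
  refine ⟨one_reflR S.one, fun h => S.nh (reflRR h), ?_, ?_, S.Cs, S.Cn, ?_, S.gn, ?_, S.cg,
    S.gc, ?_⟩
  · intro l hl s hs
    simp only [reflRows] at hs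
    have := S.Rs l hl (P.m - (s+1)) (by omega)
    rw [show P.m - (s+1) + 1 = P.m - s by omega] at this
    have := mono_step (S.Rs l hl) (P.m - s) P.m (by omega) le_rfl
    have := S.Rm l hl
    omega
  · intro l hl; simp [reflRows]
  · intro l hl
    simp only [reflRows]
    rw [show M.m - 1 - (M.m - 1 - r) = r by have := hb l hl; omega]; exact S.g1 l hl
  · intro l hl
    have := S.ra l hl
    have := hb l hl
    rw [show P.m - (P.m - 1 - a) = a + 1 by omega, show P.m - (P.m - 1 - a + 1) = a by omega]
    omega
  · intro l hl s c ho hne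
    obtain ⟨o1, o2, o3⟩ := ho
    simp only [reflRows] at o1 o2 o3
    obtain ⟨i, j, a1, a2, a3, a4, a5⟩ := S.wit l hl (P.m - 1 - s) c ⟨by omega, o2, o3⟩ (by omega)
    rw [show P.m - 1 - s + 1 = P.m - s by omega] at a2
    rw [show P.m - 1 - s = P.m - (s+1) by omega] at a1
    have := mono_step (S.Rs l hl) (P.m - s) P.m (by omega) le_rfl
    have := S.Rm l hl
    refine ⟨M.m - 1 - i, j, by omega, by omega, a3, a4, ?_⟩
    simp only [reflRows]
    rw [show M.m - 1 - (M.m - 1 - i) = i by omega]; exact a5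

theorem Sq.reflC {P M : BMat} {r a b N : ℕ} {g : ℕ → ℕ} {R C : ℕ → ℕ → ℕ}
    (S : Sq P M r a b N g R C) : Sq (reflCols P) (reflCols M) r a (P.n - 1 - b) (N-1)
      (fun l => M.n - 1 - g (N - 2 - l)) (fun l => R (N - 1 - l))
      (fun l s => M.n - C (N - 1 - l) (P.n - s)) := by
  have ha := S.one.2.1
  refine ⟨one_reflC S.one, fun h => S.nh (reflCC h), ?_, ?_, ?_, ?_, ?_, ?_, ?_, ?_, ?_, ?_⟩
  · intro l hl; exact S.Rs _ (by omega)
  · intro l hl; exact S.Rm _ (by omega)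
  · intro l hl s hs
    simp only [reflCols] at hs
    have := S.Cs (N-1-l) (by omega) (P.n - (s+1)) (by omega)
    rw [show P.n - (s+1) + 1 = P.n - s by omega] at this
    have := mono_step (S.Cs (N-1-l) (by omega)) (P.n - s) P.n (by omega) le_rfl
    have := S.Cn (N-1-l) (by omega)
    omega
  · intro l hl; simp [reflCols]
  · intro l hl
    have := S.gn (N-2-l) (by omega)
    simp only [reflCols]
    rw [show M.n - 1 - (M.n - 1 - g (N-2-l)) = g (N-2-l) by omega]; exact S.g1 _ (by omega)
  · intro l hl
    have := S.gn (N-2-l) (by omega)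
    simp only [reflCols]; omega
  · intro l hl; exact S.ra _ (by omega)
  · intro l hl
    have := S.gc (N-2-l) (by omega)
    rw [show N - 2 - l + 1 = N - 1 - l by omega] at this
    rw [show P.n - (P.n - 1 - b + 1) = b by omega]
    have := S.gn (N-2-l) (by omega)
    omega
  · intro l hl
    have := S.cg (N-2-l) (by omega)
    have := S.gn (N-2-l) (by omega)
    rw [show P.n - (P.n - 1 - b) = b + 1 by omega, show N - 1 - (l+1) = N - 2 - l by omega]
    omega
  · intro l hl s c ho hne
    obtain ⟨o1, o2, o3⟩ := ho
    simp only [reflCols] at o1 o2 o3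
    obtain ⟨i, j, a1, a2, a3, a4, a5⟩ := S.wit (N-1-l) (by omega) s (P.n - 1 - c)
      ⟨o1, by omega, o3⟩ (by omega)
    rw [show P.n - 1 - c + 1 = P.n - c by omega] at a4
    rw [show P.n - 1 - c = P.n - (c+1) by omega] at a3
    have := mono_step (S.Cs (N-1-l) (by omega)) (P.n - c) P.n (by omega) le_rfl
    have := S.Cn (N-1-l) (by omega)
    refine ⟨i, M.n - 1 - j, a1, a2, by omega, by omega, ?_⟩
    simp only [reflCols]
    rw [show M.n - 1 - (M.n - 1 - j) = j by omega]; exact a5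

theorem Sq.mono {P M : BMat} {r a b N N' : ℕ} {g : ℕ → ℕ} {R C : ℕ → ℕ → ℕ}
    (S : Sq P M r a b N g R C) (h : N' ≤ N) : Sq P M r a b N' g R C :=
  ⟨S.one, S.nh, fun l hl => S.Rs l (by omega), fun l hl => S.Rm l (by omega),
    fun l hl => S.Cs l (by omega), fun l hl => S.Cn l (by omega), fun l hl => S.g1 l (by omega),
    fun l hl => S.gn l (by omega), fun l hl => S.ra l (by omega), fun l hl => S.cg l (by omega),
    fun l hl => S.gc l (by omega), fun l hl => S.wit l (by omega)⟩

/-- the abstract mixing lemma -/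
theorem mix {P M : BMat} {r a b u v dL cR : ℕ} {g R CL CR : ℕ → ℕ} (one : One P a b)
    (hg : ∀ x y, u ≤ x → x < y → y ≤ v → g x < g y)
    (g1 : ∀ x, u ≤ x → x ≤ v → M.entry r (g x) = true)
    (hR : ∀ s, s < P.m → R s < R (s+1)) (hRm : R P.m ≤ M.m) (hra : R a ≤ r) (hra' : r < R (a+1))
    (hdL : dL ≤ b) (hcR : b ≤ cR) (hcn : cR < P.n) (huv : u + 2 * P.n + 1 ≤ v)
    (hCL : ∀ c, c < dL → CL c < CL (c+1)) (hCLu : CL dL ≤ g u)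
    (hCR : ∀ c, cR < c → c < P.n → CR c < CR (c+1)) (hCRv : g v < CR (cR+1)) (hCRn : CR P.n ≤ M.n)
    (hw : ∀ s c, One P s c → (s ≠ a ∨ c ≠ b) → (s = a ∧ dL ≤ c ∧ c ≤ cR) ∨
      ∃ i j, R s ≤ i ∧ i < R (s+1) ∧ M.entry i j = true ∧
      ((c < dL ∧ CL c ≤ j ∧ j < CL (c+1)) ∨ (c = dL ∧ CL dL ≤ j ∧ j ≤ g u) ∨
       (c = cR ∧ g v ≤ j ∧ j < CR (cR+1)) ∨ (cR < c ∧ CR c ≤ j ∧ j < CR (c+1)))) : Has P M := by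
  have hgle : ∀ x y, u ≤ x → x ≤ y → y ≤ v → g x ≤ g y := by
    intro x y h1 h2 h3
    rcases Nat.eq_or_lt_of_le h2 with h | h
    · rw [h]
    · exact (hg x y h1 h h3).le
  set D : ℕ → ℕ := fun c => if c ≤ dL then CL c else if c ≤ b then g (u + (c - dL) - 1) + 1
    else if c ≤ cR then g (v - (cR - c)) else CR c with hD
  have D1 : ∀ c, c ≤ dL → D c = CL c := fun c h => by simp only [hD]; rw [if_pos h]
  have D2 : ∀ c, dL < c → c ≤ b → D c = g (u + (c - dL) - 1) + 1 := fun c h h' => by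
    simp only [hD]; rw [if_neg (by omega), if_pos h']
  have D3 : ∀ c, b < c → c ≤ cR → D c = g (v - (cR - c)) := fun c h h' => by
    simp only [hD]; rw [if_neg (by omega), if_neg (by omega), if_pos h']
  have D4 : ∀ c, cR < c → D c = CR c := fun c h => by
    simp only [hD]; rw [if_neg (by omega), if_neg (by omega), if_neg (by omega)]
  have hb := one.2.1
  -- left and right bounds of the block of `b`
  have Bl : D b ≤ g (u + P.n) := by
    by_cases h : b = dL
    · rw [D1 b (by omega), h]; have := hgle u (u + P.n) (by omega) (by omega) (by omega); omega
    · rw [D2 b (by omega) le_rfl]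
      have := hg (u + (b - dL) - 1) (u + P.n) (by omega) (by omega) (by omega); omega
  have Br : g (u + P.n) < D (b+1) := by
    by_cases h : b = cR
    · rw [D4 (b+1) (by omega), h]; have := hgle (u + P.n) v (by omega) (by omega) (by omega); omega
    · rw [D3 (b+1) (by omega) (by omega)]
      exact hg _ _ (by omega) (by omega) (by omega)
  have hDs : ∀ c, c < P.n → D c < D (c+1) := by
    intro c hc
    rcases lt_trichotomy c b with h | h | h
    · rcases lt_trichotomy c dL with h' | h' | h'
      · rw [D1 c (by omega), D1 (c+1) (by omega)]; exact hCL c h'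
      · rw [D1 c (by omega), D2 (c+1) (by omega) (by omega), h',
          show u + (dL + 1 - dL) - 1 = u by omega]; omega
      · rw [D2 c (by omega) (by omega), D2 (c+1) (by omega) (by omega)]
        have := hg (u + (c - dL) - 1) (u + (c + 1 - dL) - 1) (by omega) (by omega) (by omega)
        omega
    · subst h; omega
    · rcases lt_trichotomy c cR with h' | h' | h'
      · rw [D3 c (by omega) (by omega), D3 (c+1) (by omega) (by omega)]
        exact hg _ _ (by omega) (by omega) (by omega)
      · rw [D3 c (by omega) (by omega), D4 (c+1) (by omega), h', show v - (cR - cR) = v by omega]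
        exact hCRv
      · rw [D4 c (by omega), D4 (c+1) (by omega)]; exact hCR c h' hc
  refine has_of_loose (by have := one.1; omega) (by omega) R D hR hDs hRm
    (by rw [D4 P.n (by omega)]; exact hCRn) ?_
  intro s c hs hc hP
  by_cases he : s ≠ a ∨ c ≠ b
  swap
  · push Not at he
    obtain ⟨rfl, rfl⟩ := he
    exact ⟨r, g (u + P.n), hra, hra', Bl, Br, g1 _ (by omega) (by omega)⟩
  rcases hw s c ⟨hs, hc, hP⟩ he with ⟨rfl, h1, h2⟩ | ⟨i, j, i1, i2, hij, h⟩
  · rcases lt_trichotomy c b with h | h | h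
    · refine ⟨r, g (u + (c - dL)), hra, hra', ?_, ?_, g1 _ (by omega) (by omega)⟩
      · by_cases h' : c = dL
        · rw [D1 c (by omega), h', show u + (dL - dL) = u by omega]; exact hCLu
        · rw [D2 c (by omega) (by omega)]
          have := hg (u + (c - dL) - 1) (u + (c - dL)) (by omega) (by omega) (by omega)
          omega
      · rw [D2 (c+1) (by omega) (by omega), show u + (c + 1 - dL) - 1 = u + (c - dL) by omega]
        omega
    · omega
    · refine ⟨r, g (v - (cR - c)), hra, hra', ?_, ?_, g1 _ (by omega) (by omega)⟩
      · rw [D3 c (by omega) (by omega)]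
      · have := hDs c hc
        rw [D3 c (by omega) (by omega)] at this
        exact this
  · rcases h with ⟨h1, h2, h3⟩ | ⟨h1, h2, h3⟩ | ⟨h1, h2, h3⟩ | ⟨h1, h2, h3⟩
    · exact ⟨i, j, i1, i2, by rw [D1 c (by omega)]; exact h2,
        by rw [D1 (c+1) (by omega)]; exact h3, hij⟩
    · subst h1
      refine ⟨i, j, i1, i2, by rw [D1 c (by omega)]; exact h2, ?_, hij⟩
      by_cases h' : c = b
      · subst h'
        have := hgle u (u + P.n) (by omega) (by omega) (by omega)
        omega
      · rw [D2 (c+1) (by omega) (by omega), show u + (c + 1 - c) - 1 = u by omega]; omega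
    · subst h1
      refine ⟨i, j, i1, i2, ?_, by rw [D4 (c+1) (by omega)]; exact h3, hij⟩
      by_cases h' : c = b
      · subst h'
        have := hgle (u + P.n) v (by omega) (by omega) (by omega)
        omega
      · rw [D3 c (by omega) (by omega), show v - (c - c) = v by omega]; omega
    · exact ⟨i, j, i1, i2, by rw [D4 c (by omega)]; exact h2,
        by rw [D4 (c+1) (by omega)]; exact h3, hij⟩

/-- mixing of two members of a sequence -/
theorem Sq.mix {P M : BMat} {r a b N : ℕ} {g : ℕ → ℕ} {R C : ℕ → ℕ → ℕ}
    (S : Sq P M r a b N g R C) {i j dL cR : ℕ} (hij : i + 2 * P.n + 3 ≤ j) (hj : j < N)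
    (σ : ℕ → ℕ) (hσ : ∀ s, σ s < N)
    (hs : ∀ s, s < P.m → s = a ∨ R (σ s) s ≤ R (σ (s+1)) s ∨ R (σ s) (s+1) ≤ R (σ (s+1)) (s+1))
    (hdL : dL ≤ b) (hcR : b ≤ cR) (hcn : cR < P.n)
    (hw : ∀ s c, One P s c → (s ≠ a ∨ c ≠ b) → (s = a ∧ dL ≤ c ∧ c ≤ cR) ∨
      (c ≤ dL ∧ R (σ s) s ≤ R i s ∧ R i (s+1) ≤ R (σ (s+1)) (s+1)) ∨
      (cR ≤ c ∧ R (σ s) s ≤ R j s ∧ R j (s+1) ≤ R (σ (s+1)) (s+1))) : False := by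
  apply S.nh
  have ha := S.one.1
  have hb := S.one.2.1
  have c1 := mono_step (S.Cs i (by omega))
  have c2 := mono_step (S.Cs j (by omega))
  have q1 := S.cg i (by omega)
  have q2 := S.gc (j-1) (by omega)
  rw [show j - 1 + 1 = j by omega] at q2
  refine BMat.mix (u := i) (v := j - 1) (g := g) (R := fun s => R (σ s) s) (CL := C i) (CR := C j)
    (dL := dL) (cR := cR) S.one
    ?_ ?_ ?_ (S.Rm _ (hσ _)) (S.ra _ (hσ _)).1 (S.ra _ (hσ _)).2 hdL hcR hcn (by omega) ?_ ?_ ?_ ?_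
      (S.Cn j (by omega)) ?_
  · intro x y _ h1 h2; exact S.gmono x y h1 (by omega)
  · intro x _ h; exact S.g1 x (by omega)
  · intro s hsm
    rcases hs s hsm with h | h | h
    · subst h
      have := (S.ra _ (hσ s)).1
      have := (S.ra _ (hσ (s+1))).2
      omega
    · have := S.Rs _ (hσ (s+1)) s hsm
      omega
    · have := S.Rs _ (hσ s) s hsm
      omega
  · intro c hc; exact S.Cs i (by omega) c (by omega)
  · have := c1 dL (b+1) (by omega) (by omega); omega
  · intro c _ hc; exact S.Cs j (by omega) c hc
  · have := c2 b (cR + 1) (by omega) (by omega); omega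
  · intro s c ho hne
    rcases hw s c ho hne with h | ⟨h1, h2, h3⟩ | ⟨h1, h2, h3⟩
    · exact Or.inl h
    · right
      obtain ⟨x, y, x1, x2, y1, y2, hxy⟩ := S.wit i (by omega) s c ho hne
      refine ⟨x, y, by omega, by omega, hxy, ?_⟩
      rcases Nat.eq_or_lt_of_le h1 with h | h
      · right; left
        subst h
        have := c1 (c+1) (b+1) (by omega) (by omega)
        exact ⟨rfl, y1, by omega⟩
      · left; exact ⟨h, y1, y2⟩
    · right
      obtain ⟨x, y, x1, x2, y1, y2, hxy⟩ := S.wit j (by omega) s c ho hne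
      refine ⟨x, y, by omega, by omega, hxy, ?_⟩
      rcases Nat.eq_or_lt_of_le h1 with h | h
      · right; right; left
        subst h
        have := c2 b cR (by omega) (by omega)
        exact ⟨rfl, by omega, y2⟩
      · right; right; right; exact ⟨h, y1, y2⟩

end BMat

namespace BMat

theorem block_inj {R : ℕ → ℕ} {m s t i : ℕ} (h : ∀ s, s < m → R s < R (s+1)) (hs : s < m)
    (ht : t < m) (h1 : R s ≤ i) (h2 : i < R (s+1)) (h3 : R t ≤ i) (h4 : i < R (t+1)) : s = t := by
  rcases lt_trichotomy s t with h' | h' | h'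
  · have := mono_step h (s+1) t (by omega) (by omega); omega
  · exact h'
  · have := mono_step h (t+1) s (by omega) (by omega); omega

theorem crit_cuts {P M : BMat} {r f : ℕ} (hn : ¬ Has P M) (h : Has P (setOne M r f)) :
    ∃ a b, ∃ R C : ℕ → ℕ, One P a b ∧ (∀ s, s < P.m → R s < R (s+1)) ∧ R P.m ≤ M.m ∧
      (∀ s, s < P.n → C s < C (s+1)) ∧ C P.n ≤ M.n ∧ (R a ≤ r ∧ r < R (a+1)) ∧
      (C b ≤ f ∧ f < C (b+1)) ∧ (∀ g, C b ≤ g → g < C (b+1) → M.entry r g ≠ true) ∧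
      ∀ s c, One P s c → (s ≠ a ∨ c ≠ b) →
    ∃ i j, R s ≤ i ∧ i < R (s+1) ∧ C c ≤ j ∧ j < C (c+1) ∧ M.entry i j = true := by
  obtain ⟨R, C, h1, h2, h3, h4, h5, h6, h7⟩ := h
  by_cases hx : ∃ a b, One P a b ∧ (R a ≤ r ∧ r < R (a+1)) ∧ (C b ≤ f ∧ f < C (b+1))
  · obtain ⟨a, b, ho, hr, hf⟩ := hx
    have hw : ∀ s c, One P s c → (s ≠ a ∨ c ≠ b) →
        ∃ i j, R s ≤ i ∧ i < R (s+1) ∧ C c ≤ j ∧ j < C (c+1) ∧ M.entry i j = true := by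
      intro s c hsc hne
      obtain ⟨i, j, a1, a2, a3, a4, a5⟩ := h7 s c hsc.1 hsc.2.1 hsc.2.2
      refine ⟨i, j, a1, a2, a3, a4, ?_⟩
      simp only [setOne] at a5
      split_ifs at a5 with hij
      · obtain ⟨rfl, rfl⟩ := hij
        have e1 := block_inj h5 hsc.1 ho.1 a1 a2 hr.1 hr.2
        have e2 := block_inj h6 hsc.2.1 ho.2.1 a3 a4 hf.1 hf.2
        omega
      · exact a5
    refine ⟨a, b, R, C, ho, h5, h2.le, h6, h4.le, hr, hf, ?_, hw⟩
    intro g g1 g2 hg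
    apply hn
    refine ⟨R, C, h1, h2, h3, h4, h5, h6, ?_⟩
    intro s c hs hc he
    by_cases hne : s ≠ a ∨ c ≠ b
    · exact hw s c ⟨hs, hc, he⟩ hne
    · push Not at hne
      obtain ⟨rfl, rfl⟩ := hne
      exact ⟨r, g, hr.1, hr.2, g1, g2, hg⟩
  · exfalso
    apply hn
    refine ⟨R, C, h1, h2, h3, h4, h5, h6, ?_⟩
    intro s c hs hc he
    obtain ⟨i, j, a1, a2, a3, a4, a5⟩ := h7 s c hs hc he
    refine ⟨i, j, a1, a2, a3, a4, ?_⟩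
    simp only [setOne] at a5
    split_ifs at a5 with hij
    · obtain ⟨rfl, rfl⟩ := hij
      exact absurd ⟨s, c, ⟨hs, hc, he⟩, ⟨a1, a2⟩, a3, a4⟩ hx
    · exact a5

theorem sq_of_wit {P : BMat} (h : ∀ K, Wit P K) (N : ℕ) :
    ∃ M r a b g R C, Sq P M r a b N g R C := by
  obtain ⟨M, r, F, hr, hn, hK, hF, hg⟩ := h (P.m * P.n * N + 1)
  have hc : ∀ f, ∃ a b, ∃ R C : ℕ → ℕ, f ∈ F →
      One P a b ∧ (∀ s, s < P.m → R s < R (s+1)) ∧ R P.m ≤ M.m ∧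
      (∀ s, s < P.n → C s < C (s+1)) ∧ C P.n ≤ M.n ∧ (R a ≤ r ∧ r < R (a+1)) ∧
      (C b ≤ f ∧ f < C (b+1)) ∧ (∀ g, C b ≤ g → g < C (b+1) → M.entry r g ≠ true) ∧
      ∀ s c, One P s c → (s ≠ a ∨ c ≠ b) →
    ∃ i j, R s ≤ i ∧ i < R (s+1) ∧ C c ≤ j ∧ j < C (c+1) ∧ M.entry i j = true := by
    intro f
    by_cases hf : f ∈ F
    · obtain ⟨a, b, R, C, hh⟩ := crit_cuts hn (hF f hf).2.2
      exact ⟨a, b, R, C, fun _ => hh⟩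
    · exact ⟨0, 0, id, id, fun h => absurd h hf⟩
  choose a b R C hc using hc
  obtain ⟨⟨a0, b0⟩, -, hcard⟩ := Finset.exists_lt_card_fiber_of_mul_lt_card_of_maps_to
    (s := F) (t := Finset.range P.m ×ˢ Finset.range P.n) (f := fun f => (a f, b f)) (n := N)
    (by
      intro f hf
      have := (hc f hf).1
      simp only [Finset.mem_product, Finset.mem_range]
      exact ⟨this.1, this.2.1⟩)
    (by simp only [Finset.card_product, Finset.card_range]; omega)
  set G := F.filter (fun f => (a f, b f) = (a0, b0)) with hG
  set e := G.orderEmbOfFin rfl with he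
  have hem : ∀ x, e x ∈ G := fun x => Finset.orderEmbOfFin_mem G rfl x
  set fs : ℕ → ℕ := fun l => if hl : l < G.card then e ⟨l, hl⟩ else 0 with hfs
  have fs1 : ∀ l, l ≤ N → fs l ∈ F ∧ a (fs l) = a0 ∧ b (fs l) = b0 := by
    intro l hl
    simp only [hfs]
    rw [dif_pos (by omega)]
    have := hem ⟨l, by omega⟩
    have := Finset.mem_filter.1 this
    simpa using this
  have fs2 : ∀ l, l < N → fs l < fs (l+1) := by
    intro l hl
    simp only [hfs]
    rw [dif_pos (by omega), dif_pos (by omega)]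
    apply e.strictMono
    simp
  have hgg : ∀ l, ∃ x, l < N → fs l < x ∧ x < fs (l+1) ∧ M.entry r x = true := by
    intro l
    by_cases hl : l < N
    · obtain ⟨x, hx⟩ := hg _ (fs1 l hl.le).1 _ (fs1 (l+1) hl).1 (fs2 l hl)
      exact ⟨x, fun _ => hx⟩
    · exact ⟨0, fun h => absurd h hl⟩
  choose g hgg using hgg
  have key : ∀ l, l ≤ N → _ := fun l hl => hc (fs l) (fs1 l hl).1
  have ea : ∀ l, l ≤ N → a (fs l) = a0 := fun l hl => (fs1 l hl).2.1
  have eb : ∀ l, l ≤ N → b (fs l) = b0 := fun l hl => (fs1 l hl).2.2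
  refine ⟨M, r, a0, b0, g, fun l => R (fs l), fun l => C (fs l), ?_⟩
  refine ⟨?_, hn, ?_, ?_, ?_, ?_, ?_, ?_, ?_, ?_, ?_, ?_⟩
  · have := (key 0 (by omega)).1
    rwa [ea 0 (by omega), eb 0 (by omega)] at this
  · exact fun l hl => (key l hl.le).2.1
  · exact fun l hl => (key l hl.le).2.2.1
  · exact fun l hl => (key l hl.le).2.2.2.1
  · exact fun l hl => (key l hl.le).2.2.2.2.1
  · exact fun l hl => (hgg l hl).2.2
  · intro l hl
    have := (hgg l hl).2.1
    have := (hF _ (fs1 (l+1) hl).1).1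
    omega
  · intro l hl
    have := (key l hl.le).2.2.2.2.2.1
    rwa [ea l hl.le] at this
  · intro l hl
    have h1 := (key l hl.le).2.2.2.2.2.2.1
    have h2 := (key l hl.le).2.2.2.2.2.2.2.1 (g l)
    rw [eb l hl.le] at h1 h2
    have h3 := hgg l hl
    by_contra h
    exact h2 (by omega) (by omega) h3.2.2
  · intro l hl
    have h1 := (key (l+1) hl.le).2.2.2.2.2.2.1
    have h2 := (key (l+1) hl.le).2.2.2.2.2.2.2.1 (g l)
    rw [eb (l+1) hl.le] at h1 h2
    have h3 := hgg l (by omega)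
    by_contra h
    exact h2 (by omega) (by omega) h3.2.2
  · intro l hl s c ho hne
    exact (key l hl.le).2.2.2.2.2.2.2.2 s c ho (by rw [ea l hl.le, eb l hl.le]; exact hne)

end BMat

namespace BMat

theorem Sq.twoRow1 {P M : BMat} {r a b N : ℕ} {g : ℕ → ℕ} {R C : ℕ → ℕ → ℕ}
    (S : Sq P M r a b N g R C) {t i : ℕ} (hta : t < a) (hrow : ∀ s c, One P s c → s = t ∨ s = a)
    (hE : ∃ c, b < c ∧ One P t c) (hi : ∀ l, l < N → R l (t+1) ≤ R i (t+1))
    (hN : i + (P.n + 1) * (2 * P.n + 2) < N) : False := by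
  classical
  apply S.nh
  have ha := S.one.1
  have hb := S.one.2.1
  have hiN : i < N := by omega
  have r1 := mono_step (S.Rs i hiN)
  have c1 := mono_step (S.Cs i hiN)
  obtain ⟨w, hw⟩ : ∃ w, w = 2 * P.n + 2 := ⟨_, rfl⟩
  rw [← hw] at hN
  have hst : ∀ k, k ≤ P.n → i + w + k * w < N := by
    intro k hk
    have : (k + 1) * w ≤ (P.n + 1) * w := Nat.mul_le_mul_right _ (by omega)
    rw [Nat.add_mul] at this
    omega
  have hss : ∀ k, i + w + (k+1) * w = i + w + k * w + w := by
    intro k; rw [Nat.add_mul]; omega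
  by_cases hX : ∀ k, k < P.n - b - 1 → ∃ x j, t ≤ x ∧ x < R i (t+1) ∧ g (i + w + k * w) ≤ j ∧
      j < g (i + w + (k+1) * w) ∧ M.entry x j = true
  · have hgs : ∀ k, k < P.n → g (i + w + k * w) < g (i + w + (k+1) * w) := by
      intro k hk
      exact S.gmono _ _ (by have := hss k; omega) (hst _ (by omega))
    refine BMat.mix (r := r) (u := i) (v := i + 2 * P.n + 1) (g := g) (R := fun s => if s ≤ t then s else R i s)
      (CL := C i) (CR := fun c => g (i + w + (c - b - 1) * w)) (dL := b) (cR := b) S.one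
      ?_ ?_ ?_ ?_ ?_ ?_ le_rfl le_rfl hb le_rfl ?_ ?_ ?_ ?_ ?_ ?_
    · intro x y _ h1 h2; exact S.gmono x y h1 (by have := hst 0 (by omega); omega)
    · intro x _ h; exact S.g1 x (by have := hst 0 (by omega); omega)
    · intro s hs
      have e1 := S.Rs i hiN s hs
      have e2 := r1 0 (s+1) (by omega) (by omega)
      split_ifs <;> omega
    · rw [if_neg (by omega)]; exact S.Rm i hiN
    · rw [if_neg (by omega)]; exact (S.ra i hiN).1
    · rw [if_neg (by omega)]; exact (S.ra i hiN).2
    · intro c hc; exact S.Cs i hiN c (by omega)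
    · have := c1 b (b+1) (by omega) (by omega)
      have := S.cg i hiN
      omega
    · intro c hc hc'
      have := hgs (c - b - 1) (by omega)
      rwa [show c - b - 1 + 1 = c + 1 - b - 1 by omega] at this
    · rw [show b + 1 - b - 1 = 0 by omega]
      exact S.gmono _ _ (by omega) (hst 0 (by omega))
    · exact (S.gn _ (hst _ (by omega))).le
    · intro s c ho hne
      right
      have hc := ho.2.1
      rcases hrow s c ho with rfl | rfl
      · rw [if_pos le_rfl, if_neg (by omega)]
        have e0 := r1 0 s (by omega) (by omega)
        by_cases hcb : c ≤ b
        · obtain ⟨x, y, x1, x2, y1, y2, hxy⟩ := S.wit i hiN s c ho hne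
          refine ⟨x, y, by omega, by omega, hxy, ?_⟩
          rcases Nat.eq_or_lt_of_le hcb with h | h
          · subst h
            have := S.cg i hiN
            right; left; exact ⟨rfl, y1, by omega⟩
          · left; exact ⟨h, y1, y2⟩
        · obtain ⟨x, j, x1, x2, j1, j2, hxj⟩ := hX (c - b - 1) (by omega)
          rw [show c - b - 1 + 1 = c + 1 - b - 1 by omega] at j2
          refine ⟨x, j, by omega, by omega, hxj, ?_⟩
          right; right; right
          exact ⟨by omega, j1, j2⟩
      · rw [if_neg (by omega), if_neg (by omega)]
        by_cases hcb : c < b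
        · obtain ⟨x, y, x1, x2, y1, y2, hxy⟩ := S.wit i hiN s c ho hne
          exact ⟨x, y, x1, x2, hxy, Or.inl ⟨hcb, y1, y2⟩⟩
        · have hcb' : b < c := by omega
          refine ⟨r, g (i + w + (c - b - 1) * w), (S.ra i hiN).1, (S.ra i hiN).2,
            S.g1 _ (hst _ (by omega)), ?_⟩
          right; right; right
          refine ⟨hcb', le_rfl, ?_⟩
          have := hgs (c - b - 1) (by omega)
          rwa [show c - b - 1 + 1 = c + 1 - b - 1 by omega] at this
  · push Not at hX
    obtain ⟨k, hk, hX⟩ := hX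
    have hq := hst (k+1) (by omega)
    have hpq := hss k
    obtain ⟨p, hp⟩ : ∃ p, p = i + w + k * w := ⟨_, rfl⟩
    rw [← hp] at hX hpq
    rw [hpq] at hX hq
    have hl : p + 1 < N := by omega
    have r2 := mono_step (S.Rs _ hl)
    have c2 := mono_step (S.Cs _ hl)
    have q1 := S.cg _ hl
    have q2 := S.gc p hl
    have hcs := Nat.find_spec hE
    have hcm := fun c => Nat.find_min' hE (m := c)
    obtain ⟨cR, hcR⟩ : ∃ c, c = Nat.find hE := ⟨_, rfl⟩
    rw [← hcR] at hcs hcm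
    have hcn := hcs.2.2.1
    have far : ∀ c, b < c → One P t c → ∃ x y, R (p+1) t ≤ x ∧ x < R (p+1) (t+1) ∧ C (p+1) c ≤ y ∧
        y < C (p+1) (c+1) ∧ M.entry x y = true ∧ g (p + w) ≤ y := by
      intro c hbc ho
      obtain ⟨x, y, x1, x2, y1, y2, hxy⟩ := S.wit _ hl t c ho (by omega)
      refine ⟨x, y, x1, x2, y1, y2, hxy, ?_⟩
      by_contra hlt
      have e0 := r2 0 t (by omega) (by omega)
      have e1 := hi _ hl
      have e2 := c2 b c (by omega) (by have := ho.2.1; omega)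
      exact hX x y (by omega) (by omega) (by omega) (by omega) hxy
    refine BMat.mix (r := r) (u := p + 1) (v := p + w) (g := g) (R := R (p+1))
      (CL := C (p+1)) (CR := C (p+1)) (dL := b) (cR := cR) S.one
      ?_ ?_ (S.Rs _ hl) (S.Rm _ hl) (S.ra _ hl).1 (S.ra _ hl).2 le_rfl hcs.1.le hcn (by omega)
      ?_ ?_ ?_ ?_ (S.Cn _ hl) ?_
    · intro x y _ h1 h2; exact S.gmono x y h1 (by omega)
    · intro x _ h; exact S.g1 x (by omega)
    · intro c hc; exact S.Cs _ hl c (by omega)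
    · have := c2 b (b+1) (by omega) (by omega); omega
    · intro c _ hc; exact S.Cs _ hl c hc
    · obtain ⟨x, y, x1, x2, y1, y2, hxy, hy⟩ := far cR hcs.1 hcs.2
      omega
    · intro s c ho hne
      by_cases hcb : c ≤ b
      · by_cases hh : s = a ∧ c = b
        · omega
        right
        obtain ⟨x, y, x1, x2, y1, y2, hxy⟩ := S.wit _ hl s c ho hne
        refine ⟨x, y, x1, x2, hxy, ?_⟩
        rcases Nat.eq_or_lt_of_le hcb with h | h
        · subst h
          right; left; exact ⟨rfl, y1, by omega⟩
        · left; exact ⟨h, y1, y2⟩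
      · rcases hrow s c ho with h | h
        · subst h
          right
          obtain ⟨x, y, x1, x2, y1, y2, hxy, hy⟩ := far c (by omega) ho
          refine ⟨x, y, x1, x2, hxy, ?_⟩
          have := hcm c ⟨by omega, ho⟩
          rcases Nat.eq_or_lt_of_le this with h | h
          · right; right; left; exact ⟨h.symm, hy, by rw [h]; exact y2⟩
          · right; right; right; exact ⟨h, y1, y2⟩
        · by_cases hcc : c ≤ cR
          · left; exact ⟨h, by omega, hcc⟩
          · right
            obtain ⟨x, y, x1, x2, y1, y2, hxy⟩ := S.wit _ hl s c ho hne
            exact ⟨x, y, x1, x2, hxy, by right; right; right; exact ⟨by omega, y1, y2⟩⟩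

theorem Sq.twoRow {P M : BMat} {r a b N : ℕ} {g : ℕ → ℕ} {R C : ℕ → ℕ → ℕ}
    (S : Sq P M r a b N g R C) {t : ℕ} (hta : t < a) (hrow : ∀ s c, One P s c → s = t ∨ s = a)
    (hE : ∃ c, b < c ∧ One P t c) (hW : ∃ c, c < b ∧ One P t c)
    (hN : 2 * ((P.n + 1) * (2 * P.n + 2)) + 4 ≤ N) : False := by
  obtain ⟨i, hi, hmax⟩ := Finset.exists_max_image (Finset.range N) (fun l => R l (t+1))
    ⟨0, by simp; omega⟩
  simp only [Finset.mem_range] at hi hmax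
  by_cases h : i + (P.n + 1) * (2 * P.n + 2) < N
  · exact S.twoRow1 hta hrow hE hmax h
  · have hpos : 0 < (P.n + 1) * (2 * P.n + 2) := by positivity
    refine S.reflC.twoRow1 (t := t) (i := N - 1 - i) hta ?_ ?_ ?_ ?_
    · intro s c ho
      obtain ⟨o1, o2, o3⟩ := ho
      simp only [reflCols] at o1 o2 o3
      exact hrow s (P.n - 1 - c) ⟨o1, by omega, o3⟩
    · obtain ⟨c, h1, h2⟩ := hW
      have := S.one.2.1
      exact ⟨P.n - 1 - c, by omega, one_reflC h2⟩
    · intro l hl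
      rw [show N - 1 - (N - 1 - i) = i by omega]
      exact hmax _ (by omega)
    · simp only [reflCols]; omega

end BMat

namespace BMat

theorem QF.no {P : BMat} (h : QF P) {i1 j1 i2 j2 i3 j3 : ℕ} (o1 : One P i1 j1) (o2 : One P i2 j2)
    (o3 : One P i3 j3) (h1 : i1 < i2) (h2 : i2 < i3)
    (hj : (j1 < j2 ∧ j3 < j2 ∧ j1 ≠ j3) ∨ (j2 < j1 ∧ j2 < j3 ∧ j1 ≠ j3)) : False := by
  have := h _ _ _ _ _ _ o1 o2 o3 h1 h2 (by omega) (by omega) (by omega)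
  omega

theorem one_of_reflC {P : BMat} {s c : ℕ} (h : One (reflCols P) s c) :
    c < P.n ∧ One P s (P.n - 1 - c) := by
  obtain ⟨o1, o2, o3⟩ := h
  simp only [reflCols] at o1 o2 o3
  exact ⟨o2, o1, by omega, o3⟩

theorem one_of_reflR {P : BMat} {s c : ℕ} (h : One (reflRows P) s c) :
    s < P.m ∧ One P (P.m - 1 - s) c := by
  obtain ⟨o1, o2, o3⟩ := h
  simp only [reflRows] at o1 o2 o3
  exact ⟨o1, by omega, o2, o3⟩

theorem QF.rC {P : BMat} (h : QF P) : QF (reflCols P) := by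
  intro i1 j1 i2 j2 i3 j3 o1 o2 o3 h1 h2 _ _ _
  have p1 := one_of_reflC o1
  have p2 := one_of_reflC o2
  have p3 := one_of_reflC o3
  have := h _ _ _ _ _ _ p1.2 p2.2 p3.2 h1 h2 (by omega) (by omega) (by omega)
  omega

theorem QF.rR {P : BMat} (h : QF P) : QF (reflRows P) := by
  intro i1 j1 i2 j2 i3 j3 o1 o2 o3 h1 h2 _ _ _
  have p1 := one_of_reflR o1
  have p2 := one_of_reflR o2
  have p3 := one_of_reflR o3
  have := h _ _ _ _ _ _ p3.2 p2.2 p1.2 (by omega) (by omega) (by omega) (by omega) (by omega)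
  omega

theorem exists_greatest {p : ℕ → Prop} {n : ℕ} (h : ∃ c, p c) (hn : ∀ c, p c → c < n) :
    ∃ d, p d ∧ ∀ c, p c → c ≤ d := by
  classical
  obtain ⟨c0, hc0⟩ := h
  refine ⟨Nat.findGreatest p n, Nat.findGreatest_spec (hn c0 hc0).le hc0, ?_⟩
  intro c hc
  exact Nat.le_findGreatest (hn c hc).le hc

theorem exists_least {p : ℕ → Prop} (h : ∃ c, p c) : ∃ d, p d ∧ ∀ c, p c → d ≤ c := by
  classical
  exact ⟨Nat.find h, Nat.find_spec h, fun c hc => Nat.find_min' h hc⟩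

theorem Sq.z1 {P M : BMat} {r a b N : ℕ} {g : ℕ → ℕ} {R C : ℕ → ℕ → ℕ}
    (S : Sq P M r a b N g R C) (hN : 2 * P.n + 3 < N)
    (h : ∀ s c, One P s c → s ≠ a → c ≤ b) : False := by
  have hb := S.one.2.1
  refine S.mix (i := 0) (j := 2 * P.n + 3) (dL := b) (cR := P.n - 1) (by omega) hN (fun _ => 0)
    (fun _ => by omega) (fun _ _ => Or.inr (Or.inl le_rfl)) le_rfl (by omega) (by omega) ?_
  intro s c ho _
  have hc := ho.2.1
  by_cases hcb : c ≤ b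
  · right; left; exact ⟨hcb, le_rfl, le_rfl⟩
  · left
    refine ⟨?_, by omega, by omega⟩
    by_contra hs
    exact hcb (h s c ho hs)

theorem Sq.z1' {P M : BMat} {r a b N : ℕ} {g : ℕ → ℕ} {R C : ℕ → ℕ → ℕ}
    (S : Sq P M r a b N g R C) (hN : 2 * P.n + 4 < N)
    (h : ∀ s c, One P s c → s ≠ a → b ≤ c) : False := by
  refine S.reflC.z1 (by simp only [reflCols]; omega) ?_
  intro s c ho hs
  have := one_of_reflC ho
  have := h _ _ this.2 hs
  omega

theorem Sq.z2 {P M : BMat} {r a b N : ℕ} {g : ℕ → ℕ} {R C : ℕ → ℕ → ℕ}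
    (S : Sq P M r a b N g R C) (hQ : QF P) (hN : 2 * P.n + 3 < N)
    (hNE : ∀ s c, One P s c → s < a → c ≤ b) (hSW : ∀ s c, One P s c → a < s → b ≤ c)
    {x1 y1 x2 y2 : ℕ} (o1 : One P x1 y1) (hx1 : x1 < a) (hy1 : y1 < b)
    (o2 : One P x2 y2) (hx2 : a < x2) (hy2 : b < y2) : False := by
  obtain ⟨dL, ⟨s0, hs0, ho0⟩, hd⟩ := exists_greatest (p := fun c => ∃ s, s < a ∧ One P s c) (n := P.n)
    ⟨y1, x1, hx1, o1⟩ (fun c ⟨_, _, h⟩ => h.2.1)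
  obtain ⟨cR, ⟨s1, hs1, ho1⟩, hc⟩ := exists_least (p := fun c => ∃ s, a < s ∧ One P s c)
    ⟨y2, x2, hx2, o2⟩
  have e1 := hNE _ _ ho0 hs0
  have e2 := hSW _ _ ho1 hs1
  refine S.mix (i := 0) (j := 2 * P.n + 3) (dL := dL) (cR := cR) (by omega) hN
    (fun s => if s ≤ a then 0 else 2 * P.n + 3)
    (fun s => by split_ifs <;> omega) ?_ e1 e2 ho1.2.1 ?_
  · intro s _
    rcases lt_trichotomy s a with h | h | h
    · right; left; rw [if_pos (by omega), if_pos (by omega)]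
    · exact Or.inl h
    · right; left; rw [if_neg (by omega), if_neg (by omega)]
  · intro s c ho hne
    rcases lt_trichotomy s a with h | h | h
    · right; left; rw [if_pos (by omega), if_pos (by omega)]
      exact ⟨hd c ⟨s, h, ho⟩, le_rfl, le_rfl⟩
    · left
      subst h
      refine ⟨rfl, ?_, ?_⟩
      · by_contra hlt
        exact hQ.no ho0 ho o2 hs0 hx2 (by omega)
      · by_contra hlt
        exact hQ.no o1 ho ho1 hx1 hs1 (by omega)
    · right; right; rw [if_neg (by omega), if_neg (by omega)]
      exact ⟨hc c ⟨s, h, ho⟩, le_rfl, le_rfl⟩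

theorem Sq.z2' {P M : BMat} {r a b N : ℕ} {g : ℕ → ℕ} {R C : ℕ → ℕ → ℕ}
    (S : Sq P M r a b N g R C) (hQ : QF P) (hN : 2 * P.n + 4 < N)
    (hNE : ∀ s c, One P s c → s < a → b ≤ c) (hSW : ∀ s c, One P s c → a < s → c ≤ b)
    {x1 y1 x2 y2 : ℕ} (o1 : One P x1 y1) (hx1 : x1 < a) (hy1 : b < y1)
    (o2 : One P x2 y2) (hx2 : a < x2) (hy2 : y2 < b) : False := by
  have hb := S.one.2.1
  have q1 := o1.2.1
  have q2 := o2.2.1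
  refine S.reflC.z2 hQ.rC (by simp only [reflCols]; omega) ?_ ?_ (one_reflC o1) hx1 (by omega)
    (one_reflC o2) hx2 (by omega)
  · intro s c ho hs
    have := one_of_reflC ho
    have := hNE _ _ this.2 hs
    omega
  · intro s c ho hs
    have := one_of_reflC ho
    have := hSW _ _ this.2 hs
    omega

theorem Sq.farE {P M : BMat} {r a b N : ℕ} {g : ℕ → ℕ} {R C : ℕ → ℕ → ℕ}
    (S : Sq P M r a b N g R C) (hQ : QF P) (hN : 2 * ((P.n + 1) * (2 * P.n + 2)) + 4 ≤ N)
    {t y1 y2 : ℕ} (ht : t < a) (o1 : One P t y1) (hy1 : y1 < b) (o2 : One P t y2) (hy2 : b < y2)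
    (hrow : ∀ s c, One P s c → s < a → c ≠ b → s = t) :
    ∀ w, One P a w → b < w → ∀ s c, One P s c → s ≠ a → b < c → w ≤ c := by
  intro w ow hw s0 c0 oc0 hs0 hc0
  by_contra hcw
  obtain ⟨c, ⟨⟨s, hsa, oc⟩, hbc⟩, hmin⟩ := exists_least
    (p := fun c => (∃ s, s ≠ a ∧ One P s c) ∧ b < c) ⟨c0, ⟨s0, hs0, oc0⟩, hc0⟩
  have hcw' := hmin c0 ⟨⟨s0, hs0, oc0⟩, hc0⟩
  have noSE : ∀ x, a < x → ¬ One P x c := by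
    intro x hx ox
    exact hQ.no o1 ow ox ht hx (by omega)
  have hsa' : s < a := by
    by_contra h
    exact noSE s (by omega) oc
  have hst := hrow s c oc hsa' (by omega)
  subst hst
  refine S.twoRow ht ?_ ⟨y2, hy2, o2⟩ ⟨y1, hy1, o1⟩ hN
  intro x y ox
  rcases lt_trichotomy x a with h | h | h
  · left
    by_cases hyb : y = b
    · subst hyb
      rcases lt_trichotomy x s with h' | h' | h'
      · exact (hQ.no ox o1 ow h' ht (by omega)).elim
      · exact h'
      · exact (hQ.no oc ox ow h' h (by omega)).elim
    · exact hrow x y ox h hyb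
  · exact Or.inr h
  · exfalso
    rcases lt_trichotomy y b with h' | h' | h'
    · exact hQ.no oc ow ox ht h (by omega)
    · exact hQ.no o1 ow ox ht h (by omega)
    · have := hmin y ⟨⟨x, by omega, ox⟩, h'⟩
      rcases Nat.eq_or_lt_of_le this with e | e
      · subst e; exact noSE x h ox
      · exact hQ.no oc S.one ox ht h (by omega)

theorem Sq.farW {P M : BMat} {r a b N : ℕ} {g : ℕ → ℕ} {R C : ℕ → ℕ → ℕ}
    (S : Sq P M r a b N g R C) (hQ : QF P) (hN : 2 * ((P.n + 1) * (2 * P.n + 2)) + 5 ≤ N)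
    {t y1 y2 : ℕ} (ht : t < a) (o1 : One P t y1) (hy1 : y1 < b) (o2 : One P t y2) (hy2 : b < y2)
    (hrow : ∀ s c, One P s c → s < a → c ≠ b → s = t) :
    ∀ w, One P a w → w < b → ∀ s c, One P s c → s ≠ a → c < b → c ≤ w := by
  intro w ow hw s c oc hs hc
  have q0 := S.one.2.1
  have q1 := o1.2.1
  have q2 := o2.2.1
  have q3 := ow.2.1
  have q4 := oc.2.1
  have := S.reflC.farE hQ.rC (by simp only [reflCols]; omega) ht (one_reflC o2) (by omega)
    (one_reflC o1) (by omega) (by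
      intro s c ho hs hc
      have := one_of_reflC ho
      exact hrow _ _ this.2 hs (by omega)) _ (one_reflC ow) (by omega) _ _ (one_reflC oc) hs
      (by omega)
  omega

end BMat

namespace BMat

theorem pick_min (f : ℕ → ℕ) (i j : ℕ) : ∃ p, (p = i ∨ p = j) ∧ f p ≤ f i ∧ f p ≤ f j := by
  rcases le_total (f i) (f j) with h | h
  · exact ⟨i, Or.inl rfl, le_rfl, h⟩
  · exact ⟨j, Or.inr rfl, h, le_rfl⟩

theorem pick_max (f : ℕ → ℕ) (i j : ℕ) : ∃ p, (p = i ∨ p = j) ∧ f i ≤ f p ∧ f j ≤ f p := by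
  rcases le_total (f i) (f j) with h | h
  · exact ⟨j, Or.inr rfl, h, le_rfl⟩
  · exact ⟨i, Or.inl rfl, le_rfl, h⟩

theorem down_choice {P : BMat} {a b i j dL cR : ℕ} {R : ℕ → ℕ → ℕ} (hQ : QF P) (one : One P a b)
    (hdL : dL ≤ b) (hcR : b ≤ cR)
    (hoff : ∀ s c, One P s c → s ≠ a → (c ≤ dL ∨ cR ≤ c) ∧ (c = b → b = dL ∧ b = cR)) :
    ∃ dn : ℕ → ℕ, (∀ s, dn s = i ∨ dn s = j) ∧
      (∀ s, a < s → R (dn s) s ≤ R (dn (s+1)) s ∨ R (dn s) (s+1) ≤ R (dn (s+1)) (s+1)) ∧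
      ∀ s c, One P s c → a < s →
        (c ≤ dL ∧ R (dn s) s ≤ R i s ∧ R i (s+1) ≤ R (dn (s+1)) (s+1)) ∨
        (cR ≤ c ∧ R (dn s) s ≤ R j s ∧ R j (s+1) ≤ R (dn (s+1)) (s+1)) := by
  by_cases h1 : ∀ s c, One P s c → a < s → c ≤ b
  · refine ⟨fun _ => i, fun _ => Or.inl rfl, fun _ _ => Or.inl le_rfl, ?_⟩
    intro s c ho hs
    left
    have := h1 s c ho hs
    have := hoff s c ho (by omega)
    exact ⟨by omega, le_rfl, le_rfl⟩
  by_cases h2 : ∀ s c, One P s c → a < s → b ≤ c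
  · refine ⟨fun _ => j, fun _ => Or.inr rfl, fun _ _ => Or.inl le_rfl, ?_⟩
    intro s c ho hs
    right
    have := h2 s c ho hs
    have := hoff s c ho (by omega)
    exact ⟨by omega, le_rfl, le_rfl⟩
  push Not at h1 h2
  obtain ⟨t, y2, o2, ht, hy2⟩ := h1
  obtain ⟨x1, y1, o1, hx1, hy1⟩ := h2
  have rowR : ∀ s c, One P s c → a < s → b < c → s = x1 := by
    intro s c ho hs hc
    rcases lt_trichotomy s x1 with h | h | h
    · exact (hQ.no one ho o1 hs h (by omega)).elim
    · exact h
    · exact (hQ.no one o1 ho hx1 h (by omega)).elim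
  have et := rowR t y2 o2 ht hy2
  subst et
  have rowL : ∀ s c, One P s c → a < s → c < b → s = t := by
    intro s c ho hs hc
    rcases lt_trichotomy s t with h | h | h
    · exact (hQ.no one ho o2 hs h (by omega)).elim
    · exact h
    · exact (hQ.no one o2 ho ht h (by omega)).elim
  obtain ⟨p, hp, p1, p2⟩ := pick_min (fun l => R l t) i j
  obtain ⟨q, hq, q1, q2⟩ := pick_max (fun l => R l (t+1)) i j
  refine ⟨fun s => if s ≤ t then p else q, ?_, ?_, ?_⟩
  · intro s
    beta_reduce
    split_ifs
    · exact hp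
    · exact hq
  · intro s hs
    beta_reduce
    left
    rcases lt_trichotomy s t with h | h | h
    · rw [if_pos (by omega), if_pos (by omega)]
    · subst h
      rw [if_pos (by omega), if_neg (by omega)]
      rcases hq with rfl | rfl
      · exact p1
      · exact p2
    · rw [if_neg (by omega), if_neg (by omega)]
  · intro s c ho hs
    beta_reduce
    have hc := hoff s c ho (by omega)
    by_cases hst : s = t
    · subst hst
      rw [if_pos le_rfl, if_neg (by omega)]
      rcases hc.1 with h | h
      · exact Or.inl ⟨h, p1, q1⟩
      · exact Or.inr ⟨h, p2, q2⟩
    · have hcb : c = b := by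
        rcases lt_trichotomy c b with h | h | h
        · exact absurd (rowL s c ho hs h) hst
        · exact h
        · exact absurd (rowR s c ho hs h) hst
      have hc2 := hc.2 hcb
      rcases lt_or_gt_of_ne hst with h | h
      · rw [if_pos (by omega), if_pos (by omega)]
        rcases hp with rfl | rfl
        · exact Or.inl ⟨by omega, le_rfl, le_rfl⟩
        · exact Or.inr ⟨by omega, le_rfl, le_rfl⟩
      · rw [if_neg (by omega), if_neg (by omega)]
        rcases hq with rfl | rfl
        · exact Or.inl ⟨by omega, le_rfl, le_rfl⟩
        · exact Or.inr ⟨by omega, le_rfl, le_rfl⟩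

/-- common mixing for the case with ones in both upper quadrants -/
theorem Sq.z3mix {P M : BMat} {r a b N : ℕ} {g : ℕ → ℕ} {R C : ℕ → ℕ → ℕ}
    (S : Sq P M r a b N g R C) {i j dL cR t : ℕ} (hij : i + 2 * P.n + 3 ≤ j) (hj : j < N)
    (ht : t < a) (hR : R j (t+1) ≤ R i (t+1)) (hdL : dL ≤ b) (hcR : b ≤ cR) (hcn : cR < P.n)
    (dn : ℕ → ℕ) (d1 : ∀ s, dn s = i ∨ dn s = j)
    (d2 : ∀ s, a < s → R (dn s) s ≤ R (dn (s+1)) s ∨ R (dn s) (s+1) ≤ R (dn (s+1)) (s+1))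
    (d3 : ∀ s c, One P s c → a < s →
        (c ≤ dL ∧ R (dn s) s ≤ R i s ∧ R i (s+1) ≤ R (dn (s+1)) (s+1)) ∨
        (cR ≤ c ∧ R (dn s) s ≤ R j s ∧ R j (s+1) ≤ R (dn (s+1)) (s+1)))
    (hrow : ∀ s c, One P s c → s < a → c ≠ b → s = t)
    (hup : ∀ s c, One P s c → s < a → (c ≤ dL ∨ cR ≤ c) ∧
      (c = b → b = dL ∧ (s < t → b = cR)))
    (hmid : ∀ c, One P a c → (dL ≤ c ∧ c ≤ cR) ∨ (c ≤ dL ∧ dn (a+1) = i)) : False := by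
  obtain ⟨p, hp, p1, p2⟩ := pick_min (fun l => R l t) i j
  refine S.mix (i := i) (j := j) (dL := dL) (cR := cR) hij hj
    (fun s => if s ≤ t then p else if s ≤ a then i else dn s) ?_ ?_ hdL hcR hcn ?_
  · intro s
    have := d1 s
    split_ifs <;> omega
  · intro s _
    rcases lt_trichotomy s a with h | h | h
    · right; left
      rcases lt_trichotomy s t with h' | h' | h'
      · rw [if_pos (by omega), if_pos (by omega)]
      · subst h'
        rw [if_pos (by omega), if_neg (by omega), if_pos (by omega)]
        exact p1
      · rw [if_neg (by omega), if_pos (by omega), if_neg (by omega), if_pos (by omega)]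
    · exact Or.inl h
    · right
      rw [if_neg (by omega), if_neg (by omega), if_neg (by omega), if_neg (by omega)]
      exact d2 s h
  · intro s c ho hne
    rcases lt_trichotomy s a with h | h | h
    · right
      have hc := hup s c ho h
      by_cases hst : s = t
      · subst hst
        rw [if_pos (by omega), if_neg (by omega), if_pos (by omega)]
        rcases hc.1 with h' | h'
        · exact Or.inl ⟨h', p1, le_rfl⟩
        · exact Or.inr ⟨h', p2, hR⟩
      · have hcb : c = b := by
          by_contra hcb
          exact hst (hrow s c ho h hcb)
        have hc2 := hc.2 hcb
        rcases lt_or_gt_of_ne hst with h' | h'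
        · have := hc2.2 h'
          rw [if_pos (by omega), if_pos (by omega)]
          rcases hp with rfl | rfl
          · exact Or.inl ⟨by omega, le_rfl, le_rfl⟩
          · exact Or.inr ⟨by omega, le_rfl, le_rfl⟩
        · rw [if_neg (by omega), if_pos (by omega), if_neg (by omega), if_pos (by omega)]
          exact Or.inl ⟨by omega, le_rfl, le_rfl⟩
    · subst h
      rcases hmid c ho with h | ⟨h1, h2⟩
      · exact Or.inl ⟨rfl, h⟩
      · right; left
        rw [if_neg (by omega), if_pos (by omega), if_neg (by omega), if_neg (by omega), h2]
        exact ⟨h1, le_rfl, le_rfl⟩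
    · right
      rw [if_neg (by omega), if_neg (by omega), if_neg (by omega), if_neg (by omega)]
      exact d3 s c ho h

theorem Sq.z3half {P M : BMat} {r a b N : ℕ} {g : ℕ → ℕ} {R C : ℕ → ℕ → ℕ}
    (S : Sq P M r a b N g R C) (hQ : QF P) {i j t : ℕ} (hij : i + 2 * P.n + 3 ≤ j) (hj : j < N)
    (hR : R j (t+1) ≤ R i (t+1))
    {y1 y2 : ℕ} (ht : t < a) (o1 : One P t y1) (hy1 : y1 < b) (o2 : One P t y2) (hy2 : b < y2)
    (hrow : ∀ s c, One P s c → s < a → c ≠ b → s = t)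
    (hfE : ∀ w, One P a w → b < w → ∀ s c, One P s c → s ≠ a → b < c → w ≤ c)
    (hfW : ∀ w, One P a w → w < b → ∀ s c, One P s c → s ≠ a → c < b → c ≤ w) : False := by
  by_cases hWE : ∀ c, One P a c → c = b
  · obtain ⟨dn, d1, d2, d3⟩ := down_choice (i := i) (j := j) (R := R) (dL := b) (cR := b) hQ S.one
      le_rfl le_rfl (by intro s c _ _; omega)
    refine S.z3mix hij hj ht hR le_rfl le_rfl S.one.2.1 dn d1 d2 d3 hrow ?_ ?_
    · intro s c _ _; omega
    · intro c hc; have := hWE c hc; omega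
  push Not at hWE
  obtain ⟨w, ow, hwb⟩ := hWE
  have noS : ∀ s, a < s → ¬ One P s b := by
    intro s hs ho
    rcases lt_or_gt_of_ne hwb with h | h
    · exact hQ.no o2 ow ho ht hs (by omega)
    · exact hQ.no o1 ow ho ht hs (by omega)
  have Nt : ∀ s, s < t → ¬ One P s b := by
    intro s hs ho
    rcases lt_or_gt_of_ne hwb with h | h
    · exact hQ.no ho o2 ow hs ht (by omega)
    · exact hQ.no ho o1 ow hs ht (by omega)
  obtain ⟨cR, ⟨⟨sc, hsc, oc⟩, hbc⟩, hcm⟩ := exists_least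
    (p := fun c => (∃ s, s ≠ a ∧ One P s c) ∧ b < c) ⟨y2, ⟨t, by omega, o2⟩, hy2⟩
  by_cases hNN : ∃ s, s < a ∧ One P s b
  · obtain ⟨s0, hs0, oN⟩ := hNN
    have mid : ∀ c, One P a c → c ≤ cR := by
      intro c ho
      by_cases h : b < c
      · exact hfE c ho h _ _ oc hsc hbc
      · omega
    have up : ∀ s c, One P s c → s < a → (c ≤ b ∨ cR ≤ c) ∧ (c = b → b = b ∧ (s < t → b = cR)) := by
      intro s c ho hs
      constructor
      · by_cases h : b < c
        · exact Or.inr (hcm c ⟨⟨s, by omega, ho⟩, h⟩)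
        · exact Or.inl (by omega)
      · intro h
        subst h
        exact ⟨rfl, fun h => absurd ho (Nt s h)⟩
    by_cases hSE : ∃ s c, a < s ∧ b < c ∧ One P s c
    · obtain ⟨xs, ys, hxs, hys, oSE⟩ := hSE
      have noW : ∀ c, One P a c → b ≤ c := by
        intro c ho
        by_contra h
        exact hQ.no oN ho oSE hs0 hxs (by omega)
      have hw' := noW w ow
      refine S.z3mix hij hj ht hR le_rfl hbc.le oc.2.1 (fun _ => j) (fun _ => Or.inr rfl)
        (fun _ _ => Or.inl le_rfl) ?_ hrow up ?_
      · intro s c ho hs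
        right
        refine ⟨hcm c ⟨⟨s, by omega, ho⟩, ?_⟩, le_rfl, le_rfl⟩
        rcases lt_trichotomy c b with h | h | h
        · exact (hQ.no oN ow ho hs0 hs (by omega)).elim
        · subst h; exact absurd ho (noS s hs)
        · exact h
      · intro c ho
        exact Or.inl ⟨noW c ho, mid c ho⟩
    · push Not at hSE
      refine S.z3mix hij hj ht hR le_rfl hbc.le oc.2.1 (fun _ => i) (fun _ => Or.inl rfl)
        (fun _ _ => Or.inl le_rfl) ?_ hrow up ?_
      · intro s c ho hs
        left
        refine ⟨?_, le_rfl, le_rfl⟩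
        by_contra h
        exact hSE s c hs (by omega) ho
      · intro c ho
        have := mid c ho
        by_cases h : b ≤ c
        · exact Or.inl ⟨h, this⟩
        · exact Or.inr ⟨by omega, rfl⟩
  · push Not at hNN
    obtain ⟨dL, ⟨⟨sd, hsd, od⟩, hdb⟩, hdm⟩ := exists_greatest (n := P.n)
      (p := fun c => (∃ s, s ≠ a ∧ One P s c) ∧ c < b) ⟨y1, ⟨t, by omega, o1⟩, hy1⟩
      (fun c ⟨⟨_, _, h⟩, _⟩ => h.2.1)
    have hoff : ∀ s c, One P s c → s ≠ a → (c ≤ dL ∨ cR ≤ c) ∧ (c = b → b = dL ∧ b = cR) := by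
      intro s c ho hs
      rcases lt_trichotomy c b with h | h | h
      · have := hdm c ⟨⟨s, hs, ho⟩, h⟩
        omega
      · subst h
        rcases lt_or_gt_of_ne hs with h' | h'
        · exact absurd ho (hNN s h')
        · exact absurd ho (noS s h')
      · have := hcm c ⟨⟨s, hs, ho⟩, h⟩
        omega
    obtain ⟨dn, d1, d2, d3⟩ := down_choice (i := i) (j := j) (R := R) hQ S.one hdb.le hbc.le hoff
    refine S.z3mix hij hj ht hR hdb.le hbc.le oc.2.1 dn d1 d2 d3 hrow ?_ ?_
    · intro s c ho hs
      have := hoff s c ho (by omega)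
      exact ⟨this.1, fun h => ⟨(this.2 h).1, fun _ => (this.2 h).2⟩⟩
    · intro c ho
      left
      constructor
      · by_cases h : c < b
        · exact hfW c ho h _ _ od hsd hdb
        · omega
      · by_cases h : b < c
        · exact hfE c ho h _ _ oc hsc hbc
        · omega

theorem Sq.z3 {P M : BMat} {r a b N : ℕ} {g : ℕ → ℕ} {R C : ℕ → ℕ → ℕ}
    (S : Sq P M r a b N g R C) (hQ : QF P) (hN : 2 * ((P.n + 1) * (2 * P.n + 2)) + 2 * P.n + 9 ≤ N)
    {x1 y1 x2 y2 : ℕ} (hx1 : x1 < a) (o1 : One P x1 y1) (hy1 : y1 < b)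
    (hx2 : x2 < a) (o2 : One P x2 y2) (hy2 : b < y2) : False := by
  have rowR : ∀ s c, One P s c → s < a → b < c → s = x1 := by
    intro s c ho hs hc
    rcases lt_trichotomy s x1 with h | h | h
    · exact (hQ.no ho o1 S.one h hx1 (by omega)).elim
    · exact h
    · exact (hQ.no o1 ho S.one h hs (by omega)).elim
  have et := rowR x2 y2 o2 hx2 hy2
  subst et
  have hrow : ∀ s c, One P s c → s < a → c ≠ b → s = x2 := by
    intro s c ho hs hc
    rcases lt_or_gt_of_ne hc with hc | hc
    · rcases lt_trichotomy s x2 with h | h | h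
      · exact (hQ.no ho o2 S.one h hx2 (by omega)).elim
      · exact h
      · exact (hQ.no o2 ho S.one h hs (by omega)).elim
    · exact rowR s c ho hs hc
  have hfE := S.farE hQ (by omega) hx1 o1 hy1 o2 hy2 hrow
  have hfW := S.farW hQ (by omega) hx1 o1 hy1 o2 hy2 hrow
  rcases le_total (R (2 * P.n + 4) (x2+1)) (R 1 (x2+1)) with h | h
  · exact S.z3half hQ (i := 1) (j := 2 * P.n + 4) (by omega) (by omega) h hx1 o1 hy1 o2 hy2 hrow
      hfE hfW
  · have q0 := S.one.2.1
    have q1 := o1.2.1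
    have q2 := o2.2.1
    refine S.reflC.z3half hQ.rC (i := N - 1 - (2 * P.n + 4)) (j := N - 2) (t := x2)
      (by simp only [reflCols]; omega) (by omega) ?_ hx1 (one_reflC o2) (by omega) (one_reflC o1)
      (by omega) ?_ ?_ ?_
    · rw [show N - 1 - (N - 2) = 1 by omega,
        show N - 1 - (N - 1 - (2 * P.n + 4)) = 2 * P.n + 4 by omega]
      exact h
    · intro s c ho hs hc
      have := one_of_reflC ho
      exact hrow _ _ this.2 hs (by omega)
    · intro w ow hw s c ho hs hc
      have h1 := one_of_reflC ow
      have h2 := one_of_reflC ho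
      have := hfW _ h1.2 (by omega) _ _ h2.2 hs (by omega)
      omega
    · intro w ow hw s c ho hs hc
      have h1 := one_of_reflC ow
      have h2 := one_of_reflC ho
      have := hfE _ h1.2 (by omega) _ _ h2.2 hs (by omega)
      omega

theorem no_sq {P M : BMat} {r a b N : ℕ} {g : ℕ → ℕ} {R C : ℕ → ℕ → ℕ}
    (S : Sq P M r a b N g R C) (hQ : QF P)
    (hN : 2 * ((P.n + 1) * (2 * P.n + 2)) + 2 * P.n + 9 ≤ N) : False := by
  by_cases hNW : ∃ x y, x < a ∧ One P x y ∧ y < b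
  · obtain ⟨x1, y1, h1, o1, k1⟩ := hNW
    by_cases hNE : ∃ x y, x < a ∧ One P x y ∧ b < y
    · obtain ⟨x2, y2, h2, o2, k2⟩ := hNE
      exact S.z3 hQ hN h1 o1 k1 h2 o2 k2
    by_cases hSE : ∃ x y, a < x ∧ One P x y ∧ b < y
    · obtain ⟨x3, y3, h3, o3, k3⟩ := hSE
      by_cases hSW : ∃ x y, a < x ∧ One P x y ∧ y < b
      · obtain ⟨x4, y4, h4, o4, k4⟩ := hSW
        have p3 := o3.1
        have p4 := o4.1
        have p := S.one.1
        exact S.reflR.z3 hQ.rR (by simp only [reflRows]; omega) (by omega) (one_reflR o4) k4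
          (by omega) (one_reflR o3) k3
      · push Not at hSW hNE
        exact S.z2 hQ (by omega) (fun s c ho hs => hNE s c hs ho) (fun s c ho hs => hSW s c hs ho)
          o1 h1 k1 o3 h3 k3
    · push Not at hSE hNE
      refine S.z1 (by omega) ?_
      intro s c ho hs
      rcases lt_or_gt_of_ne hs with h | h
      · exact hNE s c h ho
      · exact hSE s c h ho
  · by_cases hSW : ∃ x y, a < x ∧ One P x y ∧ y < b
    · obtain ⟨x4, y4, h4, o4, k4⟩ := hSW
      by_cases hSE : ∃ x y, a < x ∧ One P x y ∧ b < y
      · obtain ⟨x3, y3, h3, o3, k3⟩ := hSE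
        have p3 := o3.1
        have p4 := o4.1
        have p := S.one.1
        exact S.reflR.z3 hQ.rR (by simp only [reflRows]; omega) (by omega) (one_reflR o4) k4
          (by omega) (one_reflR o3) k3
      by_cases hNE : ∃ x y, x < a ∧ One P x y ∧ b < y
      · obtain ⟨x2, y2, h2, o2, k2⟩ := hNE
        push Not at hSE hNW
        exact S.z2' hQ (by omega) (fun s c ho hs => hNW s c hs ho) (fun s c ho hs => hSE s c hs ho)
          o2 h2 k2 o4 h4 k4
      · push Not at hSE hNE
        refine S.z1 (by omega) ?_
        intro s c ho hs
        rcases lt_or_gt_of_ne hs with h | h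
        · exact hNE s c h ho
        · exact hSE s c h ho
    · push Not at hSW hNW
      refine S.z1' (by omega) ?_
      intro s c ho hs
      rcases lt_or_gt_of_ne hs with h | h
      · exact hNW s c h ho
      · exact hSW s c h ho

theorem rowBounded_of_QF {P : BMat} (hQ : QF P) : RowBounded (Av P) := by
  by_contra h
  obtain ⟨M, r, a, b, g, R, C, S⟩ := sq_of_wit (wit_of_not_rowBounded h)
    (2 * ((P.n + 1) * (2 * P.n + 2)) + 2 * P.n + 9)
  exact no_sq S hQ le_rfl

theorem QF_of_rowBounded {P : BMat} (h : RowBounded (Av P)) : QF P := by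
  by_contra hQ
  obtain ⟨K, hK⟩ := not_wit_of_rowBounded h
  exact hK (wit_of_not_QF hQ K)

theorem QF.tr {P : BMat} (h : QF P) : QF (transposeB P) := by
  intro i1 j1 i2 j2 i3 j3 o1 o2 o3 h1 h2 d1 d2 d3
  have p1 : One P j1 i1 := ⟨o1.2.1, o1.1, o1.2.2⟩
  have p2 : One P j2 i2 := ⟨o2.2.1, o2.1, o2.2.2⟩
  have p3 : One P j3 i3 := ⟨o3.2.1, o3.1, o3.2.2⟩
  by_contra hc
  rcases lt_or_gt_of_ne d1 with e1 | e1 <;> rcases lt_or_gt_of_ne d2 with e2 | e2 <;>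
    rcases lt_or_gt_of_ne d3 with e3 | e3 <;> first
    | omega
    | exact h.no p1 p2 p3 (by omega) (by omega) (by omega)
    | exact h.no p1 p3 p2 (by omega) (by omega) (by omega)
    | exact h.no p2 p1 p3 (by omega) (by omega) (by omega)
    | exact h.no p2 p3 p1 (by omega) (by omega) (by omega)
    | exact h.no p3 p1 p2 (by omega) (by omega) (by omega)
    | exact h.no p3 p2 p1 (by omega) (by omega) (by omega)

theorem QF_of_has {P P' : BMat} (h : Has P P') (hQ : QF P') : QF P := by
  obtain ⟨R, C, h1, h2, h3, h4, h5, h6, h7⟩ := h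
  have lift : ∀ s c, One P s c → ∃ i j, One P' i j ∧ R s ≤ i ∧ i < R (s+1) ∧ C c ≤ j ∧
      j < C (c+1) := by
    intro s c ho
    obtain ⟨i, j, a1, a2, a3, a4, a5⟩ := h7 s c ho.1 ho.2.1 ho.2.2
    have e1 := mono_step h5 (s+1) P.m ho.1 le_rfl
    have e2 := mono_step h6 (c+1) P.n ho.2.1 le_rfl
    exact ⟨i, j, ⟨by omega, by omega, a5⟩, a1, a2, a3, a4⟩
  have cmono : ∀ c c' j j', c < c' → c' < P.n → j < C (c+1) → C c' ≤ j' → j < j' := by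
    intro c c' j j' k1 k2 k3 k4
    have := mono_step h6 (c+1) c' (by omega) (by omega)
    omega
  have rmono : ∀ c c' j j', c < c' → c' < P.m → j < R (c+1) → R c' ≤ j' → j < j' := by
    intro c c' j j' k1 k2 k3 k4
    have := mono_step h5 (c+1) c' (by omega) (by omega)
    omega
  intro i1 j1 i2 j2 i3 j3 o1 o2 o3 k1 k2 d1 d2 d3
  obtain ⟨x1, y1, p1, a1, a2, a3, a4⟩ := lift _ _ o1
  obtain ⟨x2, y2, p2, b1, b2, b3, b4⟩ := lift _ _ o2
  obtain ⟨x3, y3, p3, c1, c2, c3, c4⟩ := lift _ _ o3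
  have r12 := rmono i1 i2 x1 x2 k1 o2.1 a2 b1
  have r23 := rmono i2 i3 x2 x3 k2 o3.1 b2 c1
  have m12 := fun h => cmono j1 j2 y1 y2 h o2.2.1 a4 b3
  have m21 := fun h => cmono j2 j1 y2 y1 h o1.2.1 b4 a3
  have m23 := fun h => cmono j2 j3 y2 y3 h o3.2.1 b4 c3
  have m32 := fun h => cmono j3 j2 y3 y2 h o2.2.1 c4 b3
  have m13 := fun h => cmono j1 j3 y1 y3 h o3.2.1 a4 c3
  have m31 := fun h => cmono j3 j1 y3 y1 h o1.2.1 c4 a3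
  have := hQ _ _ _ _ _ _ p1 p2 p3 r12 r23 (by omega) (by omega) (by omega)
  omega

theorem colBounded_of_tr {P : BMat} (h : RowBounded (Av (transposeB P))) : ColBounded (Av P) := by
  obtain ⟨K, hK⟩ := h
  have av : ∀ M, transposeB M ∈ Av (transposeB P) ↔ M ∈ Av P := by
    intro M
    simp only [Av, Avoids, Set.mem_setOf_eq, minor_iff_has]
    exact not_congr ⟨fun h => h.tr, fun h => h.tr⟩
  refine ⟨K, ?_⟩
  intro M hM c hc
  refine hK (transposeB M) ⟨(av M).2 hM.1, ?_⟩ c hc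
  intro i j hi hj he
  have := hM.2 j i hj hi he
  rw [← av] at this
  have e : transposeB (setOne M j i) = setOne (transposeB M) i j := by
    simp only [transposeB, setOne, BMat.mk.injEq, true_and]
    funext x y
    simp only [and_comm]
  rwa [e] at this

end BMat



/-- **Corollary.** If `P ≼ P'` (so that `Av(P) ⊆ Av(P')`) and `Av(P')` is
bounded, then `Av(P)` is bounded as well. -/
theorem stmt_2 (P P' : BMat) (h : IntervalMinor P P') (hb : Bounded (Av P')) :
    Bounded (Av P) := by
  
  have hQ : QF P := QF_of_has (minor_iff_has.1 h) (QF_of_rowBounded hb.1)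
  exact ⟨rowBounded_of_QF hQ, colBounded_of_tr (rowBounded_of_QF hQ.tr)⟩
end

section
/- For every binary pattern P that contains Q₁ as an interval minor, the class Av(P) is row-unbounded: for every positive integer p there exists a matrix that is critical for Av(P) and has a row containing at least p 0-runs. -/
namespace BMat

/-- Exact partition witness that `M` contains `P`. -/
def Cov (P M : BMat) : Prop :=
  ∃ r c : ℕ → ℕ, r 0 = 0 ∧ c 0 = 0 ∧ r P.m = M.m ∧ c P.n = M.n ∧
    (∀ i, i < P.m → r i < r (i + 1)) ∧ (∀ j, j < P.n → c j < c (j + 1)) ∧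
    ∀ i j, i < P.m → j < P.n → P.entry i j = true →
      ∃ a b, r i ≤ a ∧ a < r (i + 1) ∧ c j ≤ b ∧ b < c (j + 1) ∧ M.entry a b = true

lemma gap (f : ℕ → ℕ) (k : ℕ) (h : ∀ i, i < k → f i < f (i + 1)) (i : ℕ) :
    ∀ d, i + d ≤ k → f i + d ≤ f (i + d) := by
  intro d
  induction d with
  | zero => intro _; simp
  | succ d ih =>
    intro hd
    have h1 := ih (by omega)
    have h2 := h (i + d) (by omega)
    have : i + (d + 1) = i + d + 1 := by omega
    rw [this]; omega

lemma gap' (f : ℕ → ℕ) (k : ℕ) (h : ∀ i, i < k → f i < f (i + 1)) (i j : ℕ)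
    (hij : i ≤ j) (hj : j ≤ k) : f i + j ≤ f j + i := by
  have := gap f k h i (j - i) (by omega)
  have e : i + (j - i) = j := by omega
  rw [e] at this; omega

lemma cov_of_minor (P M : BMat) (h : IntervalMinor P M) : Cov P M := by
  obtain ⟨M', hM, hm, hn, hdom⟩ := h
  induction hM using Relation.ReflTransGen.head_induction_on with
  | refl =>
    refine ⟨id, id, rfl, rfl, hm.symm, hn.symm, fun i _ => Nat.lt_succ_self i,
      fun i _ => Nat.lt_succ_self i, ?_⟩
    intro i j hi hj hP
    exact ⟨i, j, le_refl _, Nat.lt_succ_self i, le_refl _, Nat.lt_succ_self j, hdom i j hi hj hP⟩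
  | head hc _ ih =>
    obtain ⟨r, c, hr0, hc0, hrm, hcn, hr, hcc, he⟩ := ih
    rcases hc with ⟨x, hx, h1, h2, h3⟩ | ⟨x, hx, h1, h2, h3⟩
    · refine ⟨fun i => if r i ≤ x then r i else r i + 1, c, by simp [hr0], hc0, ?_, by omega, ?_,
        hcc, ?_⟩
      · dsimp only
        split_ifs <;> omega
      · intro i hi
        have := hr i hi
        show (if r i ≤ x then r i else r i + 1) < (if r (i+1) ≤ x then r (i+1) else r (i+1) + 1)
        split_ifs <;> omega
      · intro i j hi hj hP
        obtain ⟨a, b, q1, q2, q3, q4, q5⟩ := he i j hi hj hP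
        have g1 := gap' r P.m hr (i+1) P.m (by omega) le_rfl
        have g2 := gap' c P.n hcc (j+1) P.n (by omega) le_rfl
        rw [h3 a b (by omega) (by omega)] at q5
        show ∃ a b, (if r i ≤ x then r i else r i + 1) ≤ a ∧
          a < (if r (i+1) ≤ x then r (i+1) else r (i+1) + 1) ∧ _
        split_ifs at q5 with s1 s2
        · exact ⟨a, b, by split_ifs <;> omega, by split_ifs <;> omega, q3, q4, q5⟩
        · rcases Bool.or_eq_true _ _ ▸ q5 with q | q
          · exact ⟨x, b, by split_ifs <;> omega, by split_ifs <;> omega, q3, q4, q⟩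
          · exact ⟨x+1, b, by split_ifs <;> omega, by split_ifs <;> omega, q3, q4, q⟩
        · exact ⟨a+1, b, by split_ifs <;> omega, by split_ifs <;> omega, q3, q4, q5⟩
    · refine ⟨r, fun i => if c i ≤ x then c i else c i + 1, hr0, by simp [hc0], by omega, ?_, hr,
        ?_, ?_⟩
      · dsimp only
        split_ifs <;> omega
      · intro i hi
        have := hcc i hi
        show (if c i ≤ x then c i else c i + 1) < (if c (i+1) ≤ x then c (i+1) else c (i+1) + 1)
        split_ifs <;> omega
      · intro i j hi hj hP
        obtain ⟨a, b, q1, q2, q3, q4, q5⟩ := he i j hi hj hP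
        have g1 := gap' r P.m hr (i+1) P.m (by omega) le_rfl
        have g2 := gap' c P.n hcc (j+1) P.n (by omega) le_rfl
        rw [h3 a b (by omega) (by omega)] at q5
        show ∃ a b, r i ≤ a ∧ a < r (i+1) ∧ (if c j ≤ x then c j else c j + 1) ≤ b ∧
          b < (if c (j+1) ≤ x then c (j+1) else c (j+1) + 1) ∧ _
        split_ifs at q5 with s1 s2
        · exact ⟨a, b, q1, q2, by split_ifs <;> omega, by split_ifs <;> omega, q5⟩
        · rcases Bool.or_eq_true _ _ ▸ q5 with q | q
          · exact ⟨a, x, q1, q2, by split_ifs <;> omega, by split_ifs <;> omega, q⟩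
          · exact ⟨a, x+1, q1, q2, by split_ifs <;> omega, by split_ifs <;> omega, q⟩
        · exact ⟨a, b+1, q1, q2, by split_ifs <;> omega, by split_ifs <;> omega, q5⟩

lemma exists_gap (f : ℕ → ℕ) (k m : ℕ) (h0 : f 0 = 0) (hk : f k = m) (hkm : k < m)
    (h : ∀ i, i < k → f i < f (i + 1)) : ∃ i, i < k ∧ f i + 2 ≤ f (i + 1) := by
  by_contra hcon
  push Not at hcon
  have : ∀ i, i ≤ k → f i ≤ i := by
    intro i
    induction i with
    | zero => intro _; omega
    | succ i ih => intro hi; have := ih (by omega); have := hcon i (by omega); omega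
  have := this k le_rfl
  omega

lemma id_of_eq (f : ℕ → ℕ) (k : ℕ) (h0 : f 0 = 0) (hk : f k = k)
    (h : ∀ i, i < k → f i < f (i + 1)) (i : ℕ) (hi : i ≤ k) : f i = i := by
  have := gap' f k h 0 i (by omega) hi
  have := gap' f k h i k hi le_rfl
  omega

lemma minor_of_cov (P : BMat) : ∀ d (M : BMat), M.m + M.n = d → Cov P M → IntervalMinor P M := by
  intro d
  induction d with
  | zero =>
    rintro M hd ⟨r, c, hr0, hc0, hrm, hcn, hr, hcc, he⟩
    have := gap' r P.m hr 0 P.m (by omega) le_rfl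
    have := gap' c P.n hcc 0 P.n (by omega) le_rfl
    exact ⟨M, .refl, by omega, by omega, fun i j hi => by omega⟩
  | succ d ih =>
    rintro M hd ⟨r, c, hr0, hc0, hrm, hcn, hr, hcc, he⟩
    have g1 := gap' r P.m hr 0 P.m (by omega) le_rfl
    have g2 := gap' c P.n hcc 0 P.n (by omega) le_rfl
    by_cases hm : P.m < M.m
    · obtain ⟨x, hx, hx2⟩ := exists_gap r P.m M.m hr0 hrm hm hr
      have gx := gap' r P.m hr (x+1) P.m (by omega) le_rfl
      let B : BMat := ⟨M.m - 1, M.n, fun i j => if i < r x then M.entry i j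
        else if i = r x then (M.entry (r x) j || M.entry (r x + 1) j)
        else M.entry (i + 1) j⟩
      have hB : Con M B := Or.inl ⟨r x, by omega, by show M.m - 1 + 1 = M.m; omega, rfl,
        fun i j _ _ => rfl⟩
      have : IntervalMinor P B := by
        refine ih B (by show M.m - 1 + M.n = d; omega) ?_
        refine ⟨fun i => if i ≤ x then r i else r i - 1, c, by simp [hr0], hc0, ?_, hcn, ?_,
          hcc, ?_⟩
        · show (if P.m ≤ x then r P.m else r P.m - 1) = M.m - 1
          split_ifs <;> omega
        · intro i hi
          have := hr i hi
          have m2 : x + 1 ≤ i → r (x + 1) ≤ r i := fun hh => by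
            have := gap' r P.m hr (x+1) i hh (by omega); omega
          show (if i ≤ x then r i else r i - 1) < (if i + 1 ≤ x then r (i+1) else r (i+1) - 1)
          by_cases hix : i = x
          · subst hix; split_ifs <;> omega
          · split_ifs <;> omega
        · intro i j hi hj hP
          obtain ⟨a, b, q1, q2, q3, q4, q5⟩ := he i j hi hj hP
          show ∃ a b, (if i ≤ x then r i else r i - 1) ≤ a ∧
            a < (if i + 1 ≤ x then r (i+1) else r (i+1) - 1) ∧ c j ≤ b ∧ b < c (j+1) ∧
            (if a < r x then M.entry a b
              else if a = r x then (M.entry (r x) b || M.entry (r x + 1) b)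
              else M.entry (a + 1) b) = true
          have m1 : i + 1 ≤ x → r (i + 1) ≤ r x := fun hh => by
            have := gap' r P.m hr (i+1) x hh (by omega); omega
          have m2 : x + 1 ≤ i → r (x + 1) ≤ r i := fun hh => by
            have := gap' r P.m hr (x+1) i hh (by omega); omega
          have m3 : i = x → r i = r x ∧ r (i+1) = r (x+1) := by rintro rfl; simp
          by_cases s1 : a < r x
          · refine ⟨a, b, by split_ifs <;> omega, by split_ifs <;> omega, q3, q4, ?_⟩
            rw [if_pos s1]; exact q5
          · by_cases s2 : a = r x
            · refine ⟨r x, b, by split_ifs <;> omega, by split_ifs <;> omega, q3, q4, ?_⟩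
              subst s2; simp [q5]
            · by_cases s3 : a = r x + 1
              · refine ⟨r x, b, by split_ifs <;> omega, by split_ifs <;> omega, q3, q4, ?_⟩
                subst s3; simp [q5]
              · refine ⟨a - 1, b, by split_ifs <;> omega, by split_ifs <;> omega, q3, q4, ?_⟩
                rw [if_neg (by omega), if_neg (by omega), Nat.sub_add_cancel (by omega)]; exact q5
      obtain ⟨M', h1, h2⟩ := this
      exact ⟨M', .head hB h1, h2⟩
    · by_cases hn : P.n < M.n
      · obtain ⟨x, hx, hx2⟩ := exists_gap c P.n M.n hc0 hcn hn hcc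
        have gx := gap' c P.n hcc (x+1) P.n (by omega) le_rfl
        let B : BMat := ⟨M.m, M.n - 1, fun i j => if j < c x then M.entry i j
          else if j = c x then (M.entry i (c x) || M.entry i (c x + 1))
          else M.entry i (j + 1)⟩
        have hB : Con M B := Or.inr ⟨c x, by omega, by show M.n - 1 + 1 = M.n; omega, rfl,
          fun i j _ _ => rfl⟩
        have : IntervalMinor P B := by
          refine ih B (by show M.m + (M.n - 1) = d; omega) ?_
          refine ⟨r, fun i => if i ≤ x then c i else c i - 1, hr0, by simp [hc0], hrm, ?_, hr,
            ?_, ?_⟩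
          · show (if P.n ≤ x then c P.n else c P.n - 1) = M.n - 1
            split_ifs <;> omega
          · intro i hi
            have := hcc i hi
            have m2 : x + 1 ≤ i → c (x + 1) ≤ c i := fun hh => by
              have := gap' c P.n hcc (x+1) i hh (by omega); omega
            show (if i ≤ x then c i else c i - 1) < (if i + 1 ≤ x then c (i+1) else c (i+1) - 1)
            by_cases hix : i = x
            · subst hix; split_ifs <;> omega
            · split_ifs <;> omega
          · intro j i hj hi hP
            obtain ⟨b, a, q3, q4, q1, q2, q5⟩ := he j i hj hi hP
            show ∃ b a, r j ≤ b ∧ b < r (j+1) ∧ (if i ≤ x then c i else c i - 1) ≤ a ∧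
              a < (if i + 1 ≤ x then c (i+1) else c (i+1) - 1) ∧
              (if a < c x then M.entry b a
                else if a = c x then (M.entry b (c x) || M.entry b (c x + 1))
                else M.entry b (a + 1)) = true
            have m1 : i + 1 ≤ x → c (i + 1) ≤ c x := fun hh => by
              have := gap' c P.n hcc (i+1) x hh (by omega); omega
            have m2 : x + 1 ≤ i → c (x + 1) ≤ c i := fun hh => by
              have := gap' c P.n hcc (x+1) i hh (by omega); omega
            have m3 : i = x → c i = c x ∧ c (i+1) = c (x+1) := by rintro rfl; simp
            by_cases s1 : a < c x
            · refine ⟨b, a, q3, q4, by split_ifs <;> omega, by split_ifs <;> omega, ?_⟩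
              rw [if_pos s1]; exact q5
            · by_cases s2 : a = c x
              · refine ⟨b, c x, q3, q4, by split_ifs <;> omega, by split_ifs <;> omega, ?_⟩
                subst s2; simp [q5]
              · by_cases s3 : a = c x + 1
                · refine ⟨b, c x, q3, q4, by split_ifs <;> omega, by split_ifs <;> omega, ?_⟩
                  subst s3; simp [q5]
                · refine ⟨b, a - 1, q3, q4, by split_ifs <;> omega, by split_ifs <;> omega, ?_⟩
                  rw [if_neg (by omega), if_neg (by omega), Nat.sub_add_cancel (by omega)]
                  exact q5
        obtain ⟨M', h1, h2⟩ := this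
        exact ⟨M', .head hB h1, h2⟩
      · refine ⟨M, .refl, by omega, by omega, ?_⟩
        intro i j hi hj hP
        obtain ⟨a, b, q1, q2, q3, q4, q5⟩ := he i j hi hj hP
        have e1 := id_of_eq r P.m hr0 (by omega) hr i (by omega)
        have e2 := id_of_eq r P.m hr0 (by omega) hr (i+1) (by omega)
        have e3 := id_of_eq c P.n hc0 (by omega) hcc j (by omega)
        have e4 := id_of_eq c P.n hc0 (by omega) hcc (j+1) (by omega)
        have : a = i := by omega
        have : b = j := by omega
        subst a b; exact q5

lemma minor_iff (P M : BMat) : IntervalMinor P M ↔ Cov P M :=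
  ⟨cov_of_minor P M, minor_of_cov P _ M rfl⟩

lemma minor_mono (P M N : BMat) (hm : M.m = N.m) (hn : M.n = N.n)
    (h : ∀ i j, M.entry i j = true → N.entry i j = true) (hM : IntervalMinor P M) :
    IntervalMinor P N := by
  rw [minor_iff] at *
  obtain ⟨r, c, hr0, hc0, hrm, hcn, hr, hcc, he⟩ := hM
  refine ⟨r, c, hr0, hc0, hrm.trans hm, hcn.trans hn, hr, hcc, fun i j hi hj hP => ?_⟩
  obtain ⟨a, b, q1, q2, q3, q4, q5⟩ := he i j hi hj hP
  exact ⟨a, b, q1, q2, q3, q4, h a b q5⟩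

lemma minor_of_emb (P M : BMat) (f g : ℕ → ℕ) (hPm : 0 < P.m) (hPn : 0 < P.n)
    (hf : ∀ i, i + 1 < P.m → f i < f (i + 1)) (hg : ∀ i, i + 1 < P.n → g i < g (i + 1))
    (hfm : ∀ i, i < P.m → f i < M.m) (hgn : ∀ i, i < P.n → g i < M.n)
    (h : ∀ i j, i < P.m → j < P.n → M.entry (f i) (g j) = true) : IntervalMinor P M := by
  rw [minor_iff]
  refine ⟨fun i => if i = 0 then 0 else if i < P.m then f i else M.m,
    fun i => if i = 0 then 0 else if i < P.n then g i else M.n, rfl, rfl, ?_, ?_, ?_, ?_, ?_⟩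
  · simp; omega
  · simp; omega
  · intro i hi
    have h1 := hfm i hi
    dsimp only
    by_cases hi' : i + 1 < P.m
    · have h2 := hf i hi'
      rw [if_neg (show ¬ (i + 1 = 0) by omega), if_pos hi', if_pos hi]
      split_ifs <;> omega
    · rw [if_neg (show ¬ (i + 1 = 0) by omega), if_neg hi', if_pos hi]
      split_ifs <;> omega
  · intro i hi
    have h1 := hgn i hi
    dsimp only
    by_cases hi' : i + 1 < P.n
    · have h2 := hg i hi'
      rw [if_neg (show ¬ (i + 1 = 0) by omega), if_pos hi', if_pos hi]
      split_ifs <;> omega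
    · rw [if_neg (show ¬ (i + 1 = 0) by omega), if_neg hi', if_pos hi]
      split_ifs <;> omega
  · intro i j hi hj _
    have h1 := hfm i hi
    have h2 := hgn j hj
    refine ⟨f i, g j, ?_, ?_, ?_, ?_, h i j hi hj⟩ <;> dsimp only
    · rw [if_pos hi]; split_ifs <;> omega
    · rw [if_neg (show ¬ (i + 1 = 0) by omega)]
      by_cases hi' : i + 1 < P.m
      · rw [if_pos hi']; exact hf i hi'
      · rw [if_neg hi']; exact h1
    · rw [if_pos hj]; split_ifs <;> omega
    · rw [if_neg (show ¬ (j + 1 = 0) by omega)]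
      by_cases hi' : j + 1 < P.n
      · rw [if_pos hi']; exact hg j hi'
      · rw [if_neg hi']; exact h2

lemma exists_critical_s3 (P : BMat) : ∀ d (M : BMat),
    (((Finset.range M.m) ×ˢ (Finset.range M.n)).filter
      (fun x => M.entry x.1 x.2 = false)).card = d → M ∈ Av P →
    ∃ N, CriticalFor (Av P) N ∧ N.m = M.m ∧ N.n = M.n ∧
      ∀ i j, M.entry i j = true → N.entry i j = true := by
  intro d
  induction d using Nat.strong_induction_on with
  | _ d ih =>
    intro M hd hM
    by_cases hc : CriticalFor (Av P) M
    · exact ⟨M, hc, rfl, rfl, fun _ _ h => h⟩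
    · have : ∃ i j, i < M.m ∧ j < M.n ∧ M.entry i j = false ∧ setOne M i j ∈ Av P := by
        by_contra hcon
        push Not at hcon
        exact hc ⟨hM, hcon⟩
      obtain ⟨i, j, hi, hj, hij, hS⟩ := this
      obtain ⟨N, h1, h2, h3, h4⟩ := ih _ (by
        rw [← hd]
        apply Finset.card_lt_card
        refine Finset.ssubset_iff_of_subset ?_ |>.2 ⟨(i, j), ?_, ?_⟩
        · intro x hx
          simp [setOne] at hx ⊢
          exact ⟨hx.1, hx.2.2⟩
        · simp [hi, hj, hij]
        · simp [setOne]) (setOne M i j) rfl hS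
      refine ⟨N, h1, h2, h3, fun a b hab => h4 a b ?_⟩
      simp [setOne, hab]

open Classical in
/-- The construction. -/
noncomputable def cons (k l a1 a3 b1 b2 b3 p : ℕ) : BMat :=
  ⟨a1 + 1 + p * (a3 - a1) + (k - 1 - a3), b2 + p * (b3 - b2 + 1) + (l - 1 - b3), fun i j =>
    decide (i < a1 ∨ j < b2 ∨ a1 + 1 + p * (a3 - a1) ≤ i ∨ b2 + p * (b3 - b2 + 1) ≤ j ∨
      (i = a1 ∧ ∀ t < p, j ≠ b1 + t * (b3 - b2 + 1)) ∨
      (∃ t u, t + u + 1 = p ∧ a1 + 1 + u * (a3 - a1) ≤ i ∧ i < a1 + 1 + u * (a3 - a1) + (a3 - a1) ∧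
        b2 + t * (b3 - b2 + 1) ≤ j ∧ j < b2 + t * (b3 - b2 + 1) + (b3 - b2 + 1)))⟩

lemma cons_iff (k l a1 a3 b1 b2 b3 p i j : ℕ) : (cons k l a1 a3 b1 b2 b3 p).entry i j = true ↔
    (i < a1 ∨ j < b2 ∨ a1 + 1 + p * (a3 - a1) ≤ i ∨ b2 + p * (b3 - b2 + 1) ≤ j ∨
      (i = a1 ∧ ∀ t < p, j ≠ b1 + t * (b3 - b2 + 1)) ∨
      (∃ t u, t + u + 1 = p ∧ a1 + 1 + u * (a3 - a1) ≤ i ∧ i < a1 + 1 + u * (a3 - a1) + (a3 - a1) ∧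
        b2 + t * (b3 - b2 + 1) ≤ j ∧ j < b2 + t * (b3 - b2 + 1) + (b3 - b2 + 1))) := by
  simp [cons]

lemma mul_gap (t t' L : ℕ) (h : t < t') : t * L + L ≤ t' * L := by
  have := Nat.mul_le_mul_right L (show t + 1 ≤ t' from h)
  rwa [Nat.add_mul, Nat.one_mul] at this

lemma cons_avoids (P : BMat) (a1 a2 a3 b1 b2 b3 p : ℕ) (ha1 : a1 < a2) (ha2 : a2 < a3)
    (ha3 : a3 < P.m) (hb2 : b2 < b1) (hb1 : b1 < b3) (hb3 : b3 < P.n)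
    (h1 : P.entry a1 b1 = true) (h2 : P.entry a2 b2 = true) (h3 : P.entry a3 b3 = true) :
    cons P.m P.n a1 a3 b1 b2 b3 p ∈ Av P := by
  intro hM
  obtain ⟨r, c, hr0, hc0, hrm, hcn, hr, hcc, he⟩ := cov_of_minor _ _ hM
  obtain ⟨x1, y1, q1⟩ := he a1 b1 (by omega) (by omega) h1
  obtain ⟨x2, y2, q2⟩ := he a2 b2 (by omega) (by omega) h2
  obtain ⟨x3, y3, q3⟩ := he a3 b3 (by omega) (by omega) h3
  rw [cons_iff] at q1 q2 q3
  have hrm' : r P.m = a1 + 1 + p * (a3 - a1) + (P.m - 1 - a3) := hrm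
  have hcn' : c P.n = b2 + p * (b3 - b2 + 1) + (P.n - 1 - b3) := hcn
  clear he hM hrm hcn
  have G := gap' r P.m hr
  have H := gap' c P.n hcc
  have g1 := G 0 a1 (by omega) (by omega)
  have g2 := G (a1+1) a2 (by omega) (by omega)
  have g3 := G (a2+1) a3 (by omega) (by omega)
  have g4 := G (a3+1) P.m (by omega) (by omega)
  have g5 := G (a1+1) a3 (by omega) (by omega)
  have k1 := H 0 b2 (by omega) (by omega)
  have k2 := H (b2+1) b1 (by omega) (by omega)
  have k3 := H (b1+1) b3 (by omega) (by omega)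
  have k4 := H (b3+1) P.n (by omega) (by omega)
  clear G H hr hcc
  obtain ⟨q21, q22, q23, q24, q2⟩ := q2
  obtain ⟨q31, q32, q33, q34, q3⟩ := q3
  obtain ⟨q11, q12, q13, q14, q1⟩ := q1
  replace q2 := q2.resolve_left (by clear q1 q2 q3; omega)
  replace q2 := q2.resolve_left (by clear q1 q2 q3; omega)
  replace q2 := q2.resolve_left (by clear q1 q2 q3; omega)
  replace q2 := q2.resolve_left (by clear q1 q2 q3; omega)
  replace q2 := q2.resolve_left (by clear q1 q2 q3; omega)
  replace q3 := q3.resolve_left (by clear q1 q2 q3; omega)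
  replace q3 := q3.resolve_left (by clear q1 q2 q3; omega)
  replace q3 := q3.resolve_left (by clear q1 q2 q3; omega)
  replace q3 := q3.resolve_left (by clear q1 q2 q3; omega)
  replace q3 := q3.resolve_left (by clear q1 q2 q3; omega)
  replace q1 := q1.resolve_left (by clear q1 q2 q3; omega)
  replace q1 := q1.resolve_left (by clear q1 q2 q3; omega)
  replace q1 := q1.resolve_left (by clear q1 q2 q3; omega)
  replace q1 := q1.resolve_left (by clear q1 q2 q3; omega)
  have B1 := q1
  clear q1
  obtain ⟨t, u, htu, p1, p2, p3, p4⟩ := q2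
  obtain ⟨t', u', htu', p1', p2', p3', p4'⟩ := q3
  have ht : t' = t := by
    clear B1
    rcases lt_trichotomy t' t with h | h | h
    · have := mul_gap t' t (b3 - b2 + 1) h
      omega
    · exact h
    · have := mul_gap u' u (a3 - a1) (by omega)
      omega
  subst ht
  have : u' = u := by clear B1; omega
  subst this
  have hy1 : y1 = b1 + t' * (b3 - b2 + 1) := by clear B1; omega
  rcases B1 with ⟨h, h'⟩ | ⟨t, u, htu'', p1'', p2'', p3'', p4''⟩
  · exact h' t' (by omega) hy1
  have ht : t = t' := by
    rcases lt_trichotomy t t' with h | h | h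
    · have := mul_gap t t' (b3 - b2 + 1) h
      omega
    · exact h
    · have := mul_gap t' t (b3 - b2 + 1) h
      omega
  subst ht
  have : u = u' := by omega
  subst this
  omega

lemma cons_crit (P : BMat) (a1 a2 a3 b1 b2 b3 p : ℕ) (ha1 : a1 < a2) (ha2 : a2 < a3)
    (ha3 : a3 < P.m) (hb2 : b2 < b1) (hb1 : b1 < b3) (hb3 : b3 < P.n) (t : ℕ) (ht : t < p) :
    IntervalMinor P (setOne (cons P.m P.n a1 a3 b1 b2 b3 p) a1 (b1 + t * (b3 - b2 + 1))) := by
  obtain ⟨u, hu⟩ : ∃ u, t + u + 1 = p := ⟨p - 1 - t, by omega⟩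
  have hu' := mul_gap u p (a3 - a1) (by omega)
  have ht' := mul_gap t p (b3 - b2 + 1) (by omega)
  refine minor_of_emb P _
    (fun i => if i ≤ a1 then i else if i ≤ a3 then a1 + 1 + u * (a3 - a1) + (i - a1 - 1)
      else a1 + 1 + p * (a3 - a1) + (i - 1 - a3))
    (fun j => if j < b2 then j else if j ≤ b3 then b2 + t * (b3 - b2 + 1) + (j - b2)
      else b2 + p * (b3 - b2 + 1) + (j - 1 - b3)) (by omega) (by omega) ?_ ?_ ?_ ?_ ?_
  · intro i hi; split_ifs <;> omega
  · intro i hi; split_ifs <;> omega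
  · intro i hi
    show _ < a1 + 1 + p * (a3 - a1) + (P.m - 1 - a3)
    split_ifs <;> omega
  · intro i hi
    show _ < b2 + p * (b3 - b2 + 1) + (P.n - 1 - b3)
    split_ifs <;> omega
  · intro i j hi hj
    generalize hx : (if i ≤ a1 then i else if i ≤ a3 then a1 + 1 + u * (a3 - a1) + (i - a1 - 1)
      else a1 + 1 + p * (a3 - a1) + (i - 1 - a3)) = x
    generalize hy : (if j < b2 then j else if j ≤ b3 then b2 + t * (b3 - b2 + 1) + (j - b2)
      else b2 + p * (b3 - b2 + 1) + (j - 1 - b3)) = y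
    by_cases hz : x = a1 ∧ y = b1 + t * (b3 - b2 + 1)
    · simp [setOne, hx, hy, hz]
    · simp only [setOne, hx, hy]
      rw [if_neg hz, cons_iff]
      by_cases s1 : i < a1
      · left; rw [if_pos (by omega)] at hx; omega
      by_cases s2 : j < b2
      · right; left; rw [if_pos s2] at hy; omega
      by_cases s3 : a3 < i
      · right; right; left; rw [if_neg (by omega), if_neg (by omega)] at hx; omega
      by_cases s4 : b3 < j
      · right; right; right; left; rw [if_neg (by omega), if_neg (by omega)] at hy; omega
      rw [if_neg s2, if_pos (by omega)] at hy
      by_cases s5 : i = a1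
      · right; right; right; right; left
        rw [if_pos (by omega)] at hx
        refine ⟨by omega, fun t' ht' hyt => ?_⟩
        rcases lt_trichotomy t' t with h | h | h
        · have := mul_gap t' t (b3 - b2 + 1) h
          omega
        · subst h; exact hz ⟨by omega, hyt⟩
        · have := mul_gap t t' (b3 - b2 + 1) h
          omega
      · right; right; right; right; right
        rw [if_neg (by omega), if_pos (by omega)] at hx
        exact ⟨t, u, hu, by omega, by omega, by omega, by omega⟩

end BMat

open BMat

/-- **Theorem.** If `P` contains `Q₁` as an interval minor, the class
`Av(P)` is row-unbounded: for every positive `p` there is a matrix critical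
for `Av(P)` having a row with at least `p` 0-runs. -/
theorem stmt_3 (P : BMat) (h : IntervalMinor Q1 P) (p : ℕ) (hp : 0 < p) :
    ∃ M, CriticalFor (Av P) M ∧ ∃ r, r < M.m ∧ p ≤ rowRunCount M r := by
  obtain ⟨r, c, hr0, hc0, hrm, hcn, hr, hcc, he⟩ := cov_of_minor _ _ h
  obtain ⟨a1, b1, q1, q2, q3, q4, h1⟩ := he 0 1 (by decide) (by decide) (by decide)
  obtain ⟨a2, b2, q5, q6, q7, q8, h2⟩ := he 1 0 (by decide) (by decide) (by decide)
  obtain ⟨a3, b3, q9, q10, q11, q12, h3⟩ := he 2 2 (by decide) (by decide) (by decide)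
  have hrm' : r 3 = P.m := hrm
  have hcn' : c 3 = P.n := hcn
  norm_num at q1 q2 q3 q4 q5 q6 q7 q8 q9 q10 q11 q12
  have ha1 : a1 < a2 := by omega
  have ha2 : a2 < a3 := by omega
  have ha3 : a3 < P.m := by omega
  have hb2 : b2 < b1 := by omega
  have hb1 : b1 < b3 := by omega
  have hb3 : b3 < P.n := by omega
  obtain ⟨N, hN, hm, hn, hdom⟩ := exists_critical_s3 P _ _ rfl
    (cons_avoids P a1 a2 a3 b1 b2 b3 p ha1 ha2 ha3 hb2 hb1 hb3 h1 h2 h3)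
  have hn' : N.n = b2 + p * (b3 - b2 + 1) + (P.n - 1 - b3) := hn
  have hm' : N.m = a1 + 1 + p * (a3 - a1) + (P.m - 1 - a3) := hm
  refine ⟨N, hN, a1, by omega, ?_⟩
  unfold rowRunCount
  have hinj : Function.Injective (fun t : ℕ => b1 + t * (b3 - b2 + 1)) := by
    intro t t' htt
    have htt' : b1 + t * (b3 - b2 + 1) = b1 + t' * (b3 - b2 + 1) := htt
    rcases lt_trichotomy t t' with h | h | h
    · have := mul_gap t t' (b3 - b2 + 1) h
      omega
    · exact h
    · have := mul_gap t' t (b3 - b2 + 1) h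
      omega
  calc p = Set.ncard ((fun t : ℕ => b1 + t * (b3 - b2 + 1)) '' (Finset.range p : Set ℕ)) := by
        rw [Set.ncard_image_of_injective _ hinj, Set.ncard_coe_finset, Finset.card_range]
    _ ≤ _ := by
        apply Set.ncard_le_ncard
        · rintro _ ⟨t, ht, rfl⟩
          have ht : t < p := by simpa using ht
          have ht' := mul_gap t p (b3 - b2 + 1) (by omega)
          refine ⟨?_, ?_, Or.inr ?_⟩
          · show b1 + t * (b3 - b2 + 1) < N.n
            omega
          · by_contra hcon
            have hcon : N.entry a1 (b1 + t * (b3 - b2 + 1)) = true := by simpa using hcon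
            refine hN.1 (minor_mono P (setOne (cons P.m P.n a1 a3 b1 b2 b3 p) a1
              (b1 + t * (b3 - b2 + 1))) N hm.symm hn.symm ?_
              (cons_crit P a1 a2 a3 b1 b2 b3 p ha1 ha2 ha3 hb2 hb1 hb3 t ht))
            intro i j hij
            simp only [setOne] at hij
            split_ifs at hij with hh
            · rw [hh.1, hh.2]; exact hcon
            · exact hdom i j hij
          · apply hdom
            rw [cons_iff]
            right; right; right; right; left
            refine ⟨rfl, fun t' _ hyt => ?_⟩
            dsimp only at hyt
            rcases lt_trichotomy t' t with h | h | h
            · have := mul_gap t' t (b3 - b2 + 1) h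
              omega
            · subst h; omega
            · have := mul_gap t t' (b3 - b2 + 1) h
              omega
        · exact (Set.finite_lt_nat N.n).subset fun j hj => hj.1
end
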